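/- arXiv:1205.6671 — 5 statements merged into one kernel-verified Lean document; each statement's English description precedes it below -/
import Mathlib

section
/- Let H be a Pommaret basis of the proper nonzero homogeneous ideal I of P for the reverse lexicographic order and, for 1 ≤ i ≤ n, let H_i = {h ∈ H : cls(lt(h)) = i}. Consider the set Q_i = {q ∈ ℕ : (⟨I, x_1,…,x_{i−1}⟩ : x_i)_q ≠ ⟨I, x_1,…,x_{i−1}⟩_q} of degrees where the colon ideal differs from ⟨I, x_1,…,x_{i−1}⟩. If H_i = ∅ then Q_i = ∅, and if H_i ≠ ∅ then Q_i is nonempty with maximum q_i = deg(H_i) − 1, where deg(H_i) is the maximal degree of an element of H_i. -/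
open MvPolynomial

/-- The (0-based) class of a nonzero exponent vector: the smallest index with
nonzero entry.  (The variables `x_1, …, x_n` of the paper are `X 0, …, X (n-1)`.) -/
noncomputable def cls {n : ℕ} (μ : Fin n →₀ ℕ) : ℕ :=
  sInf {i : ℕ | ∃ hi : i < n, μ ⟨i, hi⟩ ≠ 0}

/-- `x^μ` involutively divides `x^ν` : it divides it and the quotient only involves
the multiplicative variables `x_1, …, x_{cls μ}` of `x^μ`. -/
def InvDiv {n : ℕ} (μ ν : Fin n →₀ ℕ) : Prop :=
  μ ≤ ν ∧ ∀ j : Fin n, ν j ≠ μ j → (j : ℕ) ≤ cls μ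

/-- The exponent of the leading term of `f` with respect to the monomial order `m`. -/
noncomputable def ldeg {n : ℕ} {K : Type*} [Field K] (m : MonomialOrder (Fin n))
    (f : MvPolynomial (Fin n) K) : Fin n →₀ ℕ :=
  m.toSyn.symm (f.support.sup fun μ => m.toSyn μ)

/-- The leading ideal `lt(I)` of an ideal `I` with respect to `m`. -/
noncomputable def ltIdeal {n : ℕ} {K : Type*} [Field K] (m : MonomialOrder (Fin n))
    (I : Ideal (MvPolynomial (Fin n) K)) : Ideal (MvPolynomial (Fin n) K) :=
  Ideal.span {g | ∃ f ∈ I, f ≠ 0 ∧ g = monomial (ldeg m f) (1 : K)}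

/-- `H` is a (finite, monomial) Pommaret basis of the monomial ideal `I`:
it generates `I` and every monomial of `I` has a unique involutive divisor in `H`. -/
def IsMonPB {n : ℕ} {K : Type*} [Field K] (H : Set (Fin n →₀ ℕ))
    (I : Ideal (MvPolynomial (Fin n) K)) : Prop :=
  H.Finite ∧ I = Ideal.span ((fun μ => monomial μ (1 : K)) '' H) ∧
    ∀ ν : Fin n →₀ ℕ, monomial ν (1 : K) ∈ I → ∃! μ, μ ∈ H ∧ InvDiv μ ν

/-- `H` is a Pommaret basis of the polynomial ideal `I` w.r.t. the monomial order `m`: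
its elements lie in `I`, are nonzero with pairwise distinct leading terms, and the
leading terms form a Pommaret basis of the leading ideal. -/
def IsPB {n : ℕ} {K : Type*} [Field K] (m : MonomialOrder (Fin n))
    (H : Finset (MvPolynomial (Fin n) K)) (I : Ideal (MvPolynomial (Fin n) K)) : Prop :=
  (∀ h ∈ H, h ∈ I) ∧ (∀ h ∈ H, h ≠ 0) ∧
    Set.InjOn (fun h : MvPolynomial (Fin n) K => ldeg m h) ↑H ∧
    IsMonPB ((fun h : MvPolynomial (Fin n) K => ldeg m h) '' ↑H) (ltIdeal m I)

/-- `m` is the degree reverse lexicographic order (with the reversed conventions of the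
paper: for equal degrees, `μ ≺ ν` iff the first nonvanishing entry of `μ - ν` is positive). -/
def IsRevLex {n : ℕ} (m : MonomialOrder (Fin n)) : Prop :=
  ∀ μ ν : Fin n →₀ ℕ, m.toSyn μ < m.toSyn ν ↔
    ((μ.sum fun _ e => e) < (ν.sum fun _ e => e) ∨
      ((μ.sum fun _ e => e) = (ν.sum fun _ e => e) ∧
        ∃ i : Fin n, ν i < μ i ∧ ∀ j : Fin n, j < i → μ j = ν j))

/-- `I` is a homogeneous ideal. -/
def IsHomIdeal {n : ℕ} {K : Type*} [Field K] (I : Ideal (MvPolynomial (Fin n) K)) : Prop :=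
  ∃ S : Set (MvPolynomial (Fin n) K), (∀ f ∈ S, ∃ d, f.IsHomogeneous d) ∧ I = Ideal.span S

section helpers

variable {n : ℕ} {K : Type*} [Field K]

theorem aux_ldeg (m : MonomialOrder (Fin n)) (f : MvPolynomial (Fin n) K) :
    ldeg m f = m.degree f := rfl

theorem aux_rev {m : MonomialOrder (Fin n)} (hrev : IsRevLex m) (μ ν : Fin n →₀ ℕ) :
    m.toSyn μ < m.toSyn ν ↔ (μ.degree < ν.degree ∨ (μ.degree = ν.degree ∧
        ∃ i : Fin n, ν i < μ i ∧ ∀ j : Fin n, j < i → μ j = ν j)) := hrev μ ν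

theorem aux_deg_le {m : MonomialOrder (Fin n)} (hrev : IsRevLex m) {μ ν : Fin n →₀ ℕ}
    (h : m.toSyn μ ≤ m.toSyn ν) : μ.degree ≤ ν.degree := by
  by_contra hc
  push Not at hc
  exact absurd h (not_le.mpr ((aux_rev hrev ν μ).2 (Or.inl hc)))

/-- A term involving a variable of index below `i` is smaller than one not doing so. -/
theorem aux_small {m : MonomialOrder (Fin n)} (hrev : IsRevLex m) {μ ν : Fin n →₀ ℕ} {i : ℕ}
    (hd : μ.degree = ν.degree) (hν : ∀ j : Fin n, (j : ℕ) < i → ν j = 0)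
    (hμ : ∃ j : Fin n, (j : ℕ) < i ∧ μ j ≠ 0) : m.toSyn μ < m.toSyn ν := by
  rcases lt_trichotomy (m.toSyn μ) (m.toSyn ν) with h | h | h
  · exact h
  · have : μ = ν := m.toSyn.injective h
    subst this
    obtain ⟨j, hj, hj'⟩ := hμ
    exact absurd (hν j hj) hj'
  · exfalso
    rcases (aux_rev hrev ν μ).1 h with h | ⟨-, t, ht, htl⟩
    · omega
    · obtain ⟨j, hj, hj'⟩ := hμ
      by_cases hjt : j < t
      · have h1 := htl j hjt
        rw [hν j hj] at h1
        exact hj' h1.symm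
      · have h2 : (t : ℕ) < i := by
          have : (t : ℕ) ≤ j := by exact_mod_cast not_lt.mp hjt
          omega
        rw [hν t h2] at ht
        omega

/-- A smaller term of the same degree involves variables of index below `i` if the larger does. -/
theorem aux_down {m : MonomialOrder (Fin n)} (hrev : IsRevLex m) {μ ν : Fin n →₀ ℕ} {i : ℕ}
    (hd : μ.degree = ν.degree) (hν : ∃ j : Fin n, (j : ℕ) < i ∧ ν j ≠ 0)
    (h : m.toSyn μ ≤ m.toSyn ν) : ∃ j : Fin n, (j : ℕ) < i ∧ μ j ≠ 0 := by
  by_contra hc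
  push Not at hc
  exact absurd h (not_le.mpr (aux_small hrev hd.symm hc hν))

theorem aux_memV {i : ℕ} {f : MvPolynomial (Fin n) K} :
    f ∈ Ideal.span {p : MvPolynomial (Fin n) K | ∃ j : Fin n, (j : ℕ) < i ∧ p = X j} ↔
      ∀ μ, coeff μ f ≠ 0 → ∃ j : Fin n, (j : ℕ) < i ∧ μ j ≠ 0 := by
  have : {p : MvPolynomial (Fin n) K | ∃ j : Fin n, (j : ℕ) < i ∧ p = X j} =
      X '' {j : Fin n | (j : ℕ) < i} := by
    ext p
    simp [eq_comm]
  rw [this, mem_ideal_span_X_image]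
  simp [mem_support_iff]

theorem aux_hom_deg {f : MvPolynomial (Fin n) K} {q : ℕ} (hf : f.IsHomogeneous q)
    {μ : Fin n →₀ ℕ} (h : coeff μ f ≠ 0) : μ.degree = q := by
  rw [Finsupp.degree_eq_weight_one]
  exact hf h

theorem aux_hom_of {f : MvPolynomial (Fin n) K} {q : ℕ}
    (hf : ∀ μ, coeff μ f ≠ 0 → μ.degree = q) : f.IsHomogeneous q := by
  intro μ h
  have := hf μ h
  rw [Finsupp.degree_eq_weight_one] at this
  exact this

theorem aux_comp {I : Ideal (MvPolynomial (Fin n) K)} (hI : IsHomIdeal I)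
    {f : MvPolynomial (Fin n) K} (hf : f ∈ I) (q : ℕ) : homogeneousComponent q f ∈ I := by
  obtain ⟨S, hS, rfl⟩ := hI
  letI := MvPolynomial.gradedAlgebra (σ := Fin n) (R := K)
  have := Ideal.homogeneous_span (homogeneousSubmodule (Fin n) K) S
    (fun x hx => by
      obtain ⟨d, hd⟩ := hS x hx
      exact ⟨d, hd⟩)
  exact (mem_iff_homogeneousComponent_mem this f).1 hf q

theorem aux_degree_eq (m : MonomialOrder (Fin n)) {f : MvPolynomial (Fin n) K}
    {ν : Fin n →₀ ℕ} (h : coeff ν f ≠ 0)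
    (h' : ∀ μ, coeff μ f ≠ 0 → m.toSyn μ ≤ m.toSyn ν) : m.degree f = ν := by
  apply m.toSyn.injective
  apply le_antisymm
  · apply h'
    rw [MonomialOrder.coeff_degree_ne_zero_iff]
    rintro rfl
    simp at h
  · exact m.le_degree (mem_support_iff.2 h)

/-- Leading component. -/
theorem aux_top (m : MonomialOrder (Fin n)) {I : Ideal (MvPolynomial (Fin n) K)}
    (hI : IsHomIdeal I) {f : MvPolynomial (Fin n) K} (hf : f ∈ I) (h0 : f ≠ 0) :
    ∃ g ∈ I, g ≠ 0 ∧ g.IsHomogeneous (m.degree f).degree ∧ m.degree g = m.degree f := by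
  have hc : coeff (m.degree f) (homogeneousComponent (m.degree f).degree f) ≠ 0 := by
    rw [coeff_homogeneousComponent, if_pos rfl]
    exact m.coeff_degree_ne_zero_iff.2 h0
  refine ⟨homogeneousComponent (m.degree f).degree f, aux_comp hI hf _, ?_,
    homogeneousComponent_isHomogeneous _ _, aux_degree_eq m hc ?_⟩
  · intro h
    rw [h] at hc
    simp at hc
  · intro μ hμ
    rw [coeff_homogeneousComponent] at hμ
    apply m.le_degree
    rw [mem_support_iff]
    intro h
    simp [h] at hμ

theorem aux_lt (m : MonomialOrder (Fin n)) {I : Ideal (MvPolynomial (Fin n) K)}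
    (hI : IsHomIdeal I) {ν : Fin n →₀ ℕ} (h : monomial ν (1 : K) ∈ ltIdeal m I) :
    ∃ g ∈ I, g ≠ 0 ∧ g.IsHomogeneous ν.degree ∧ m.degree g = ν := by
  have e : {g | ∃ f ∈ I, f ≠ 0 ∧ g = monomial (ldeg m f) (1 : K)} =
      (fun s => monomial s (1 : K)) '' {s | ∃ f ∈ I, f ≠ 0 ∧ s = m.degree f} := by
    ext g
    constructor
    · rintro ⟨f, hf, h0, rfl⟩
      exact ⟨_, ⟨f, hf, h0, rfl⟩, rfl⟩
    · rintro ⟨_, ⟨f, hf, h0, rfl⟩, rfl⟩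
      exact ⟨f, hf, h0, rfl⟩
  rw [ltIdeal, e, mem_ideal_span_monomial_image] at h
  obtain ⟨_, ⟨f, hf, h0, rfl⟩, hle⟩ := h ν (by simp [mem_support_iff])
  have h1 : monomial (ν - m.degree f) (1 : K) ≠ 0 := by simp
  have h2 := aux_top m hI (I.mul_mem_left (monomial (ν - m.degree f) (1 : K)) hf)
    (mul_ne_zero h1 h0)
  classical
  rw [m.degree_mul h1 h0, m.degree_monomial, if_neg one_ne_zero, tsub_add_cancel_of_le hle] at h2
  exact h2

theorem aux_lt_mem (m : MonomialOrder (Fin n)) {I : Ideal (MvPolynomial (Fin n) K)}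
    {f : MvPolynomial (Fin n) K} (hf : f ∈ I) (h0 : f ≠ 0) :
    monomial (m.degree f) (1 : K) ∈ ltIdeal m I :=
  Ideal.subset_span ⟨f, hf, h0, rfl⟩

theorem aux_core {m : MonomialOrder (Fin n)} (hrev : IsRevLex m)
    {I : Ideal (MvPolynomial (Fin n) K)} (hI : IsHomIdeal I) {i q : ℕ}
    {f : MvPolynomial (Fin n) K} (hq : f.IsHomogeneous q) (h0 : f ≠ 0)
    (hf : f ∈ I ⊔ Ideal.span {p | ∃ j : Fin n, (j : ℕ) < i ∧ p = X j})
    (hν : ∀ j : Fin n, (j : ℕ) < i → m.degree f j = 0) :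
    monomial (m.degree f) (1 : K) ∈ ltIdeal m I := by
  obtain ⟨a, ha, b, hb, rfl⟩ := Submodule.mem_sup.1 hf
  rw [aux_memV] at hb
  set ν := m.degree (a + b) with hνdef
  have hc : coeff ν (a + b) ≠ 0 := m.coeff_degree_ne_zero_iff.2 h0
  have hνq : ν.degree = q := aux_hom_deg hq hc
  have hbν : coeff ν b = 0 := by
    by_contra hb'
    obtain ⟨j, hj, hj'⟩ := hb ν hb'
    exact hj' (hν j hj)
  have hca : coeff ν (homogeneousComponent q a) ≠ 0 := by
    rw [coeff_homogeneousComponent, if_pos hνq]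
    rw [coeff_add, hbν, add_zero] at hc
    exact hc
  have hd : m.degree (homogeneousComponent q a) = ν := by
    apply aux_degree_eq m hca
    intro μ hμ
    rw [coeff_homogeneousComponent] at hμ
    have hμq : μ.degree = q := by
      by_contra h
      simp [h] at hμ
    rw [if_pos hμq] at hμ
    by_cases hb' : coeff μ b = 0
    · apply m.le_degree
      rw [mem_support_iff, coeff_add, hb', add_zero]
      exact hμ
    · exact (aux_small hrev (hμq.trans hνq.symm) hν (hb μ hb')).le
  rw [← hd]
  apply aux_lt_mem m (aux_comp hI ha q)
  intro h
  rw [h] at hca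
  simp at hca

theorem aux_tdeg {m : MonomialOrder (Fin n)} (hrev : IsRevLex m)
    {f : MvPolynomial (Fin n) K} (h0 : f ≠ 0) : f.totalDegree = (m.degree f).degree := by
  apply le_antisymm
  · apply Finset.sup_le
    intro μ hμ
    exact aux_deg_le hrev (m.le_degree hμ)
  · exact le_totalDegree (m.degree_mem_support h0)

theorem aux_cls_spec {μ : Fin n →₀ ℕ} {i : Fin n} (h : cls μ = i) (h0 : μ ≠ 0) :
    μ i ≠ 0 ∧ ∀ j : Fin n, (j : ℕ) < i → μ j = 0 := by
  have hne : {i : ℕ | ∃ hi : i < n, μ ⟨i, hi⟩ ≠ 0}.Nonempty := by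
    by_contra hc
    apply h0
    ext j
    by_contra hj
    exact hc ⟨j, j.2, hj⟩
  refine ⟨?_, ?_⟩
  · have := Nat.sInf_mem hne
    change ∃ hi : cls μ < n, μ ⟨cls μ, hi⟩ ≠ 0 at this
    rw [h] at this
    exact this.2
  · intro j hj
    by_contra hc
    have : cls μ ≤ j := Nat.sInf_le ⟨j.2, hc⟩
    omega

theorem aux_cls_ge {μ : Fin n →₀ ℕ} {i : ℕ} (h0 : μ ≠ 0)
    (h : ∀ j : Fin n, (j : ℕ) < i → μ j = 0) : i ≤ cls μ := by
  have hne : {i : ℕ | ∃ hi : i < n, μ ⟨i, hi⟩ ≠ 0}.Nonempty := by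
    by_contra hc
    apply h0
    ext j
    by_contra hj
    exact hc ⟨j, j.2, hj⟩
  obtain ⟨h1, h2⟩ := Nat.sInf_mem hne
  by_contra hc
  push Not at hc
  exact h2 (h ⟨_, h1⟩ hc)

theorem aux_one {m : MonomialOrder (Fin n)} (hrev : IsRevLex m)
    {I : Ideal (MvPolynomial (Fin n) K)} (hIT : I ≠ ⊤) {h : MvPolynomial (Fin n) K}
    (hI : h ∈ I) (h0 : h ≠ 0) : m.degree h ≠ 0 := by
  intro hd
  apply hIT
  have := aux_tdeg hrev h0
  rw [hd] at this
  have h1 : h.totalDegree = 0 := by simpa using this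
  have h2 := totalDegree_eq_zero_iff_eq_C.1 h1
  rw [h2] at hI h0
  apply Ideal.eq_top_of_isUnit_mem _ hI
  apply IsUnit.map C
  rw [isUnit_iff_ne_zero]
  intro hz
  rw [hz] at h0
  simp at h0

theorem aux_upper {m : MonomialOrder (Fin n)} (hrev : IsRevLex m)
    {I : Ideal (MvPolynomial (Fin n) K)} (hIT : I ≠ ⊤) (hI : IsHomIdeal I)
    {H : Finset (MvPolynomial (Fin n) K)} (hPB : IsPB m H I) (i : Fin n) (q : ℕ)
    (s : m.syn) : ∀ f : MvPolynomial (Fin n) K, m.toSyn (m.degree f) = s → f.IsHomogeneous q →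
      X i * f ∈ I ⊔ Ideal.span {p | ∃ j : Fin n, (j : ℕ) < (i : ℕ) ∧ p = X j} →
      f ∉ I ⊔ Ideal.span {p | ∃ j : Fin n, (j : ℕ) < (i : ℕ) ∧ p = X j} →
      ∃ h ∈ H, cls (ldeg m h) = (i : ℕ) ∧ h.totalDegree = q + 1 := by
  induction s using WellFoundedLT.induction with
  | ind s ih =>
  intro f hs hq hX hf
  have h0 : f ≠ 0 := by
    rintro rfl
    exact hf (zero_mem _)
  have hc : coeff (m.degree f) f ≠ 0 := m.coeff_degree_ne_zero_iff.2 h0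
  have hνq : (m.degree f).degree = q := aux_hom_deg hq hc
  have hν : ∀ j : Fin n, (j : ℕ) < (i : ℕ) → m.degree f j = 0 := by
    by_contra hcon
    push Not at hcon
    apply hf
    apply Ideal.mem_sup_right
    rw [aux_memV]
    intro μ hμ
    exact aux_down hrev ((aux_hom_deg hq hμ).trans hνq.symm) hcon
      (m.le_degree (mem_support_iff.2 hμ))
  by_cases hlt : monomial (m.degree f) (1 : K) ∈ ltIdeal m I
  · have hmem := hlt
    obtain ⟨g, hgI, hg0, hgq, hgd⟩ := aux_lt m hI hmem
    rw [hνq] at hgq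
    have hgc : coeff (m.degree f) g ≠ 0 := by
      rw [← hgd]
      exact m.coeff_degree_ne_zero_iff.2 hg0
    set c := coeff (m.degree f) f / coeff (m.degree f) g with hcdef
    have hcg : C c * g ∈ I := I.mul_mem_left _ hgI
    have hcgJ : C c * g ∈ I ⊔ Ideal.span
        {p : MvPolynomial (Fin n) K | ∃ j : Fin n, (j : ℕ) < (i : ℕ) ∧ p = X j} :=
      Ideal.mem_sup_left hcg
    have hf' : f - C c * g ∉ I ⊔ Ideal.span {p | ∃ j : Fin n, (j : ℕ) < (i : ℕ) ∧ p = X j} := by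
      intro h
      apply hf
      have := Ideal.add_mem _ h hcgJ
      simpa using this
    have hf'0 : f - C c * g ≠ 0 := by
      intro h
      rw [h] at hf'
      exact hf' (zero_mem _)
    have hz : coeff (m.degree f) (f - C c * g) = 0 := by
      rw [coeff_sub, coeff_C_mul, hcdef, div_mul_cancel₀ _ hgc, sub_self]
    have hs' : m.toSyn (m.degree (f - C c * g)) < s := by
      have h1 : coeff (m.degree (f - C c * g)) (f - C c * g) ≠ 0 :=
        m.coeff_degree_ne_zero_iff.2 hf'0
      have h2 : m.degree (f - C c * g) ≠ m.degree f := by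
        intro h
        rw [h] at h1
        exact h1 hz
      rw [← hs]
      apply lt_of_le_of_ne _ (fun h => h2 (m.toSyn.injective h))
      by_cases h3 : coeff (m.degree (f - C c * g)) f = 0
      · rw [← hgd]
        apply m.le_degree
        rw [mem_support_iff]
        intro h4
        apply h1
        rw [coeff_sub, coeff_C_mul, h3, h4]
        simp
      · exact m.le_degree (mem_support_iff.2 h3)
    refine ih _ hs' _ rfl ?_ ?_ hf'
    · apply IsHomogeneous.sub hq
      simpa using (isHomogeneous_C (Fin n) c).mul hgq
    · rw [mul_sub]
      exact Ideal.sub_mem _ hX (Ideal.mul_mem_left _ _ hcgJ)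
  have hX0 : (X i : MvPolynomial (Fin n) K) ≠ 0 := X_ne_zero i
  have hXd : m.degree (X i * f) = Finsupp.single i 1 + m.degree f := by
    rw [m.degree_mul hX0 h0, m.degree_X]
  have key := aux_core hrev hI (q := 1 + q) ((isHomogeneous_X K i).mul hq)
    (mul_ne_zero hX0 h0) hX (by
      intro j hj
      rw [hXd, Finsupp.add_apply, hν j hj, Finsupp.single_apply, if_neg]
      rintro rfl
      exact lt_irrefl _ hj)
  rw [hXd] at key
  obtain ⟨hHI, hH0, -, -, hspan, huniq⟩ := hPB
  obtain ⟨μ, ⟨⟨h, hh, rfl⟩, hle, hinv⟩, -⟩ := huniq _ key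
  simp only [aux_ldeg] at hle hinv
  have hH := aux_one hrev hIT (hHI h hh) (hH0 h hh)
  have hndvd : ¬ m.degree h ≤ m.degree f := by
    intro hle'
    apply hlt
    rw [hspan, mem_ideal_span_monomial_image]
    intro ξ hξ
    have : ξ = m.degree f := by
      by_contra hne
      rw [mem_support_iff, coeff_monomial, if_neg (Ne.symm hne)] at hξ
      exact hξ rfl
    subst this
    exact ⟨_, ⟨h, hh, rfl⟩, hle'⟩
  have hi : m.degree h i = m.degree f i + 1 := by
    by_contra hne
    apply hndvd
    intro j
    have h1 := hle j
    rw [Finsupp.add_apply, Finsupp.single_apply] at h1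
    split_ifs at h1 with hij
    · subst hij
      omega
    · omega
  have hlow : ∀ j : Fin n, (j : ℕ) < (i : ℕ) → m.degree h j = 0 := by
    intro j hj
    have h1 := hle j
    rw [Finsupp.add_apply, hν j hj, Finsupp.single_apply, if_neg] at h1
    · omega
    · rintro rfl
      exact lt_irrefl _ hj
  have hcls : cls (m.degree h) = (i : ℕ) := by
    apply le_antisymm
    · exact Nat.sInf_le ⟨i.2, by rw [Fin.eta, hi]; omega⟩
    · exact aux_cls_ge hH hlow
  refine ⟨h, hh, hcls, ?_⟩
  have heq : m.degree h = Finsupp.single i 1 + m.degree f := by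
    ext j
    rcases lt_trichotomy (j : ℕ) (i : ℕ) with hj | hj | hj
    · rw [hlow j hj, Finsupp.add_apply, hν j hj, Finsupp.single_apply, if_neg]
      rintro rfl
      exact lt_irrefl _ hj
    · have : j = i := Fin.ext hj
      subst this
      rw [hi, Finsupp.add_apply, Finsupp.single_eq_same, add_comm]
    · by_contra hne
      have := hinv j (Ne.symm hne)
      omega
  rw [aux_tdeg hrev (hH0 h hh), heq, map_add, Finsupp.degree_single, hνq, add_comm]

theorem aux_lower {m : MonomialOrder (Fin n)} (hrev : IsRevLex m)
    {I : Ideal (MvPolynomial (Fin n) K)} (hIT : I ≠ ⊤) (hI : IsHomIdeal I)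
    {H : Finset (MvPolynomial (Fin n) K)} (hPB : IsPB m H I) (i : Fin n)
    {h : MvPolynomial (Fin n) K} (hh : h ∈ H) (hcls : cls (ldeg m h) = (i : ℕ)) :
    ∃ f : MvPolynomial (Fin n) K, f.IsHomogeneous (h.totalDegree - 1) ∧
      X i * f ∈ I ⊔ Ideal.span {p | ∃ j : Fin n, (j : ℕ) < (i : ℕ) ∧ p = X j} ∧
      f ∉ I ⊔ Ideal.span {p | ∃ j : Fin n, (j : ℕ) < (i : ℕ) ∧ p = X j} := by
  obtain ⟨hHI, hH0, -, -, hspan, huniq⟩ := hPB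
  have hH := aux_one hrev hIT (hHI h hh) (hH0 h hh)
  obtain ⟨hi, hlow⟩ := aux_cls_spec (i := i) hcls hH
  simp only [aux_ldeg] at hi hlow hcls
  rw [aux_tdeg hrev (hH0 h hh)]
  obtain ⟨g, hgI, hg0, hgq, hgd⟩ := aux_top m hI (hHI h hh) (hH0 h hh)
  have hle1 : Finsupp.single i 1 ≤ m.degree h := by
    rw [Finsupp.single_le_iff]
    omega
  obtain ⟨κ, hκ⟩ := le_iff_exists_add.1 hle1
  have hκq : κ.degree = (m.degree h).degree - 1 := by
    rw [hκ, map_add, Finsupp.degree_single]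
    omega
  have hgc : coeff (m.degree h) g ≠ 0 := by
    rw [← hgd]
    exact m.coeff_degree_ne_zero_iff.2 hg0
  set f := g.divMonomial (Finsupp.single i 1) with hfdef
  have hcf : ∀ μ, coeff μ f = coeff (Finsupp.single i 1 + μ) g := fun μ =>
    coeff_divMonomial _ _ _
  have hfκ : coeff κ f ≠ 0 := by
    rw [hcf, ← hκ]
    exact hgc
  have hf0 : f ≠ 0 := by
    intro h
    rw [h] at hfκ
    simp at hfκ
  have hfq : f.IsHomogeneous ((m.degree h).degree - 1) := by
    apply aux_hom_of
    intro μ hμ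
    rw [hcf] at hμ
    have := aux_hom_deg hgq hμ
    rw [map_add, Finsupp.degree_single] at this
    omega
  have hfd : m.degree f = κ := by
    apply aux_degree_eq m hfκ
    intro μ hμ
    rw [hcf] at hμ
    have := m.le_degree (mem_support_iff.2 hμ)
    rw [hgd, hκ, map_add, map_add] at this
    exact le_of_add_le_add_left this
  refine ⟨f, hfq, ?_, ?_⟩
  · have e := divMonomial_add_modMonomial_single g i
    rw [← hfdef] at e
    have e' : X i * f = g - g.modMonomial (Finsupp.single i 1) := by
      rw [eq_sub_iff_add_eq]
      exact e
    rw [e']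
    apply Ideal.sub_mem _ (Ideal.mem_sup_left hgI)
    apply Ideal.mem_sup_right
    rw [aux_memV]
    intro μ hμ
    have hnle : ¬ Finsupp.single i 1 ≤ μ := by
      intro hle
      exact hμ (coeff_modMonomial_of_le _ hle)
    rw [coeff_modMonomial_of_not_le _ hnle] at hμ
    rw [Finsupp.single_le_iff] at hnle
    have hd := aux_hom_deg hgq hμ
    have hle := m.le_degree (mem_support_iff.2 hμ)
    rw [hgd] at hle
    obtain ⟨j, hj, hj'⟩ := aux_down hrev (i := (i : ℕ) + 1) hd ⟨i, by omega, hi⟩ hle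
    refine ⟨j, ?_, hj'⟩
    rcases Nat.lt_succ_iff_lt_or_eq.1 hj with h1 | h1
    · exact h1
    · exfalso
      have : j = i := Fin.ext h1
      subst this
      omega
  · intro hfJ
    have hκlow : ∀ j : Fin n, (j : ℕ) < (i : ℕ) → κ j = 0 := by
      intro j hj
      have h1 := hlow j hj
      rw [hκ, Finsupp.add_apply] at h1
      omega
    have key := aux_core hrev hI hfq hf0 hfJ (by rw [hfd]; exact hκlow)
    rw [hfd] at key
    obtain ⟨μ, ⟨⟨h', hh', rfl⟩, hle, hinv⟩, -⟩ := huniq _ key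
    simp only [aux_ldeg] at hle hinv
    have hH' := aux_one hrev hIT (hHI h' hh') (hH0 h' hh')
    have hge : (i : ℕ) ≤ cls (m.degree h') := by
      apply aux_cls_ge hH'
      intro j hj
      have h1 := hle j
      rw [hκlow j hj] at h1
      omega
    have hu := (huniq _ (aux_lt_mem m (hHI h hh) (hH0 h hh))).unique
      (y₁ := m.degree h) (y₂ := m.degree h')
      ⟨⟨h, hh, rfl⟩, le_rfl, fun j hj => absurd rfl hj⟩
      ⟨⟨h', hh', rfl⟩, hle.trans (by rw [hκ]; exact le_add_self), ?_⟩
    · rw [← hu] at hle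
      have h1 := hle i
      rw [hκ, Finsupp.add_apply, Finsupp.single_eq_same] at h1
      omega
    · intro j hj
      by_cases hji : j = i
      · rw [hji]
        exact hge
      · apply hinv
        rw [hκ, Finsupp.add_apply, Finsupp.single_apply, if_neg (Ne.symm hji), zero_add] at hj
        exact hj

end helpers

/-- Prop. 3.2: for a Pommaret basis `H` of `I` w.r.t. revlex and each
variable `x_i` (0-based index `i`), the set `Q_i` of degrees where
`⟨I,x_1,…,x_{i-1}⟩ : x_i` differs from `⟨I,x_1,…,x_{i-1}⟩` is empty if `H_i = ∅`,
and otherwise has greatest element `deg H_i - 1`. -/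
theorem statement7 {n : ℕ} {K : Type*} [Field K] (m : MonomialOrder (Fin n))
    (hrev : IsRevLex m)
    (I : Ideal (MvPolynomial (Fin n) K)) (hI0 : I ≠ ⊥) (hIT : I ≠ ⊤) (hIhom : IsHomIdeal I)
    (H : Finset (MvPolynomial (Fin n) K)) (hPB : IsPB m H I) :
    ∀ i : Fin n,
      ((∀ h ∈ H, cls (ldeg m h) ≠ (i : ℕ)) →
        {q : ℕ | ∃ f : MvPolynomial (Fin n) K, f.IsHomogeneous q ∧
          X i * f ∈ I ⊔ Ideal.span {p | ∃ j : Fin n, (j : ℕ) < (i : ℕ) ∧ p = X j} ∧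
          f ∉ I ⊔ Ideal.span {p | ∃ j : Fin n, (j : ℕ) < (i : ℕ) ∧ p = X j}} = ∅) ∧
      (∀ Dg : ℕ,
        IsGreatest {d : ℕ | ∃ h ∈ H, cls (ldeg m h) = (i : ℕ) ∧ h.totalDegree = d} Dg →
        IsGreatest {q : ℕ | ∃ f : MvPolynomial (Fin n) K, f.IsHomogeneous q ∧
          X i * f ∈ I ⊔ Ideal.span {p | ∃ j : Fin n, (j : ℕ) < (i : ℕ) ∧ p = X j} ∧
          f ∉ I ⊔ Ideal.span {p | ∃ j : Fin n, (j : ℕ) < (i : ℕ) ∧ p = X j}} (Dg - 1)) := by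
  intro i
  refine ⟨?_, ?_⟩
  · intro hno
    rw [Set.eq_empty_iff_forall_notMem]
    rintro q ⟨f, hq, hX, hf⟩
    obtain ⟨h, hh, hc, -⟩ := aux_upper hrev hIT hIhom hPB i q _ f rfl hq hX hf
    exact hno h hh hc
  · rintro Dg ⟨⟨h, hh, hc, rfl⟩, hmax⟩
    refine ⟨aux_lower hrev hIT hIhom hPB i hh hc, ?_⟩
    rintro q ⟨f, hq, hX, hf⟩
    obtain ⟨h', hh', hc', hd'⟩ := aux_upper hrev hIT hIhom hPB i q _ f rfl hq hX hf
    have := hmax ⟨h', hh', hc', hd'⟩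
    omega
end

section
/- Let I be a proper nonzero monomial ideal of P and D the Krull dimension of P/I. Then I is quasi-stable if and only if the variable x_1 is not a zero divisor on P/I^sat and for all 1 ≤ k < D the variable x_{k+1} is not a zero divisor on P/⟨I, x_1,…,x_k⟩^sat. -/
open MvPolynomial

/-- The homogeneous maximal ideal `⟨x_1, …, x_n⟩`. -/
noncomputable def mxI (n : ℕ) (K : Type*) [Field K] : Ideal (MvPolynomial (Fin n) K) :=
  Ideal.span (Set.range X)

/-- The saturation `I : ⟨x_1,…,x_n⟩^∞` of `I`, as a set. -/
def satSet {n : ℕ} {K : Type*} [Field K] (I : Ideal (MvPolynomial (Fin n) K)) :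
    Set (MvPolynomial (Fin n) K) :=
  {f | ∃ s : ℕ, ∀ g ∈ (mxI n K ^ s : Ideal (MvPolynomial (Fin n) K)), g * f ∈ I}

/-- `I` is a monomial ideal. -/
def IsMonIdeal {n : ℕ} {K : Type*} [Field K] (I : Ideal (MvPolynomial (Fin n) K)) : Prop :=
  ∃ S : Set (Fin n →₀ ℕ), I = Ideal.span ((fun μ => monomial μ (1 : K)) '' S)

/-- A monomial ideal is quasi-stable if it possesses a finite Pommaret basis. -/
def QuasiStable {n : ℕ} {K : Type*} [Field K] (I : Ideal (MvPolynomial (Fin n) K)) : Prop :=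
  ∃ H : Set (Fin n →₀ ℕ), IsMonPB H I

namespace QS

lemma cls_spec {n : ℕ} {μ : Fin n →₀ ℕ} (h : μ ≠ 0) :
    ∃ c : Fin n, (c : ℕ) = cls μ ∧ μ c ≠ 0 ∧ ∀ j, j < c → μ j = 0 := by
  obtain ⟨i, hi⟩ := Finsupp.ne_iff.mp h
  have hne : {i : ℕ | ∃ hi : i < n, μ ⟨i, hi⟩ ≠ 0}.Nonempty := ⟨i, i.2, by simpa using hi⟩
  obtain ⟨hc, hc'⟩ := Nat.sInf_mem hne
  refine ⟨⟨cls μ, hc⟩, rfl, hc', fun j hj => ?_⟩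
  by_contra hne'
  have : cls μ ≤ j := Nat.sInf_le ⟨j.2, hne'⟩
  exact absurd hj (not_lt.mpr this)

/-- The candidate Pommaret basis. -/
def HB {n : ℕ} (M : Set (Fin n →₀ ℕ)) : Set (Fin n →₀ ℕ) :=
  {μ | μ ∈ M ∧ ∀ c : Fin n, (c : ℕ) = cls μ → μ - Finsupp.single c 1 ∉ M}

lemma sub_single_apply {n : ℕ} (μ : Fin n →₀ ℕ) (c j : Fin n) :
    (μ - Finsupp.single c 1 : Fin n →₀ ℕ) j = μ j - if j = c then 1 else 0 := by
  rw [Finsupp.tsub_apply, Finsupp.single_apply]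
  by_cases h : j = c
  · simp [h]
  · simp [h, Ne.symm h]

lemma exists_inv {n : ℕ} {M : Set (Fin n →₀ ℕ)} (h0 : (0 : Fin n →₀ ℕ) ∉ M)
    (ν : Fin n →₀ ℕ) (hν : ν ∈ M) : ∃ μ, μ ∈ HB M ∧ InvDiv μ ν := by
  induction ν using WellFoundedLT.induction with
  | ind ν ih =>
    have hne : ν ≠ 0 := fun h => h0 (h ▸ hν)
    obtain ⟨c, hc, hc0, hcl⟩ := cls_spec hne
    by_cases hm : ν - Finsupp.single c 1 ∈ M
    · have hlt : ν - Finsupp.single c 1 < ν := by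
        refine lt_of_le_of_ne tsub_le_self fun h => ?_
        have := DFunLike.congr_fun h c
        rw [sub_single_apply] at this
        simp at this
        omega
      obtain ⟨μ, hμ, hle, hd⟩ := ih _ hlt hm
      refine ⟨μ, hμ, hle.trans hlt.le, fun j hj => ?_⟩
      by_cases hjc : j = c
      · subst hjc
        obtain ⟨d, hd, hd0, hdl⟩ := cls_spec (fun h => h0 (h ▸ hμ.1) : μ ≠ 0)
        rw [← hd]
        by_contra hcon
        have h1 := hcl d (by rw [Fin.lt_def]; omega)
        have h2 := (hle.trans hlt.le) d
        omega
      · refine hd j ?_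
        rw [sub_single_apply]
        simpa [hjc] using hj
    · refine ⟨ν, ⟨hν, fun c' hc' => ?_⟩, le_rfl, fun j hj => absurd rfl hj⟩
      have : c' = c := Fin.ext (by omega)
      rwa [this]

lemma uniq_aux {n : ℕ} {M : Set (Fin n →₀ ℕ)} (hM : IsUpperSet M)
    (h0 : (0 : Fin n →₀ ℕ) ∉ M) {ν μ μ' : Fin n →₀ ℕ} (h : μ ∈ HB M) (h' : μ' ∈ HB M)
    (hd : InvDiv μ ν) (hd' : InvDiv μ' ν) (hc : cls μ ≤ cls μ') : μ = μ' := by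
  obtain ⟨c, hc1, hc2, hc3⟩ := cls_spec (fun e => h0 (e ▸ h.1) : μ ≠ 0)
  obtain ⟨d, hd1, hd2, hd3⟩ := cls_spec (fun e => h0 (e ▸ h'.1) : μ' ≠ 0)
  have key : ∀ j, c < j → ν j = μ j := fun j hj => by
    by_contra hcon
    have := hd.2 j hcon
    rw [Fin.lt_def] at hj
    omega
  have key' : ∀ j, d < j → ν j = μ' j := fun j hj => by
    by_contra hcon
    have := hd'.2 j hcon
    rw [Fin.lt_def] at hj
    omega
  have hcd : c ≤ d := by rw [Fin.le_def]; omega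
  have n1 : ¬ μ' ≤ μ - Finsupp.single c 1 := fun hle => h.2 c hc1 (hM hle h'.1)
  have n2 : ¬ μ ≤ μ' - Finsupp.single d 1 := fun hle => h'.2 d hd1 (hM hle h.1)
  rcases hcd.lt_or_eq with hlt | rfl
  · refine absurd (fun j => ?_) n1
    rw [sub_single_apply]
    have hl := hd'.1 j
    rcases lt_or_ge c j with hj | hj
    · rw [← key j hj, if_neg hj.ne']; simpa using hl
    · rw [hd3 j (lt_of_le_of_lt hj hlt)]; exact Nat.zero_le _
  · have hoff : ∀ j, j ≠ c → μ j = μ' j := fun j hj => by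
      rcases lt_or_gt_of_ne hj with hj | hj
      · rw [hc3 j hj, hd3 j hj]
      · rw [← key j hj, ← key' j hj]
    rcases lt_trichotomy (μ c) (μ' c) with hl | hl | hl
    · refine absurd (fun j => ?_) n2
      rw [sub_single_apply]
      by_cases hj : j = c
      · subst hj; simp; omega
      · simp [hj, hoff j hj]
    · ext j
      by_cases hj : j = c
      · subst hj; exact hl
      · exact hoff j hj
    · refine absurd (fun j => ?_) n1
      rw [sub_single_apply]
      by_cases hj : j = c
      · subst hj; simp; omega
      · simp [hj, hoff j hj]

/-- Keep only the entries of index at least `m`. -/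
noncomputable def trunc {n : ℕ} (m : ℕ) (ν : Fin n →₀ ℕ) : Fin n →₀ ℕ :=
  ν.filter (fun i => m ≤ (i : ℕ))

lemma trunc_apply {n : ℕ} (m : ℕ) (ν : Fin n →₀ ℕ) (j : Fin n) :
    trunc m ν j = if m ≤ (j : ℕ) then ν j else 0 := by
  simp [trunc, Finsupp.filter_apply]

lemma HB_finite {n : ℕ} {M : Set (Fin n →₀ ℕ)} (hM : IsUpperSet M)
    (h0 : (0 : Fin n →₀ ℕ) ∉ M)
    (hQ : ∀ ν ∈ M, ∀ j : Fin n, ∃ s : ℕ, trunc j ν + Finsupp.single j s ∈ M) :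
    (HB M).Finite := by
  classical
  have hG : {x | Minimal (· ∈ M) x}.Finite :=
    WellQuasiOrderedLE.finite_of_isAntichain (setOfPred_minimal_antichain _)
  choose! s hs using hQ
  obtain ⟨B, hB⟩ : ∃ B, ∀ g ∈ hG.toFinset, ∀ j, g j + s g j ≤ B := by
    refine ⟨∑ g ∈ hG.toFinset, ∑ j, (g j + s g j), fun g hg j => ?_⟩
    refine (Finset.single_le_sum (f := fun j => g j + s g j) (fun _ _ => Nat.zero_le _)
      (Finset.mem_univ j)).trans ?_
    exact Finset.single_le_sum (f := fun g : Fin n →₀ ℕ => ∑ j, (g j + s g j))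
      (fun _ _ => Nat.zero_le _) hg
  refine (Set.finite_Iic (Finsupp.equivFunOnFinite.symm (fun _ : Fin n => B))).subset ?_
  intro μ hμ j
  simp only [Finsupp.equivFunOnFinite_symm_apply_apply]
  by_contra hcon
  push Not at hcon
  obtain ⟨c, hc1, hc2, hc3⟩ := cls_spec (fun e => h0 (e ▸ hμ.1) : μ ≠ 0)
  have hcj : c ≤ j := by
    by_contra h
    have := hc3 j (not_le.mp h)
    omega
  obtain ⟨g, hgle, hg⟩ := exists_minimal_le_of_wellFoundedLT (· ∈ M) μ hμ.1
  have hb := hB g (by simpa using hg) j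
  refine hμ.2 c hc1 (hM ?_ (hs g hg.prop j))
  intro i
  rw [sub_single_apply, Finsupp.add_apply, trunc_apply, Finsupp.single_apply]
  have hgi := hgle i
  by_cases hij : i = j
  · subst hij; simp; split_ifs <;> omega
  · rw [if_neg (Ne.symm hij)]
    split_ifs with h1 h2
    · subst h2
      exact absurd (le_antisymm hcj h1) hij
    · simpa using hgi
    · omega
    · omega

variable {n : ℕ} {K : Type*} [Field K]

lemma mem_iff {J : Ideal (MvPolynomial (Fin n) K)} (hJ : IsMonIdeal J)
    (f : MvPolynomial (Fin n) K) :
    f ∈ J ↔ ∀ ν ∈ f.support, monomial ν (1 : K) ∈ J := by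
  obtain ⟨S, rfl⟩ := hJ
  rw [mem_ideal_span_monomial_image]
  refine forall₂_congr fun ν _ => ?_
  rw [mem_ideal_span_monomial_image]
  simp [support_monomial]

lemma upper (J : Ideal (MvPolynomial (Fin n) K)) :
    IsUpperSet {ν : Fin n →₀ ℕ | monomial ν (1 : K) ∈ J} := by
  intro a b hab ha
  have : monomial b (1 : K) = monomial (b - a) 1 * monomial a 1 := by
    rw [monomial_mul, tsub_add_cancel_of_le hab, one_mul]
  change monomial b (1 : K) ∈ J
  rw [this]
  exact J.mul_mem_left _ ha

/-- the ideal `⟨I, x_1, …, x_k⟩` -/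
noncomputable def Jk (I : Ideal (MvPolynomial (Fin n) K)) (k : ℕ) :
    Ideal (MvPolynomial (Fin n) K) :=
  I ⊔ Ideal.span {p | ∃ j : Fin n, (j : ℕ) < k ∧ p = X j}

lemma Jk_eq (S : Set (Fin n →₀ ℕ)) (k : ℕ) :
    Jk (Ideal.span ((fun μ => monomial μ (1 : K)) '' S)) k =
      Ideal.span ((fun μ => monomial μ (1 : K)) ''
        (S ∪ {μ | ∃ j : Fin n, (j : ℕ) < k ∧ μ = Finsupp.single j 1})) := by
  rw [Jk, Set.image_union, Ideal.span_union]
  congr 2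
  ext p
  constructor
  · rintro ⟨j, hj, rfl⟩
    exact ⟨_, ⟨j, hj, rfl⟩, rfl⟩
  · rintro ⟨_, ⟨j, hj, rfl⟩, rfl⟩
    exact ⟨j, hj, rfl⟩

lemma Jk_mon {I : Ideal (MvPolynomial (Fin n) K)} (hI : IsMonIdeal I) (k : ℕ) :
    IsMonIdeal (Jk I k) := by
  obtain ⟨S, rfl⟩ := hI
  exact ⟨_, Jk_eq S k⟩

lemma Jk_mem {I : Ideal (MvPolynomial (Fin n) K)} (hI : IsMonIdeal I) (k : ℕ)
    (ν : Fin n →₀ ℕ) : monomial ν (1 : K) ∈ Jk I k ↔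
      monomial ν (1 : K) ∈ I ∨ ∃ j : Fin n, (j : ℕ) < k ∧ ν j ≠ 0 := by
  obtain ⟨S, rfl⟩ := hI
  rw [Jk_eq, mem_ideal_span_monomial_image, mem_ideal_span_monomial_image]
  have : (monomial ν (1 : K)).support = {ν} := by
    classical rw [support_monomial, if_neg one_ne_zero]
  simp only [this, Finset.mem_singleton, forall_eq]
  constructor
  · rintro ⟨μ, h | ⟨j, hj, rfl⟩, hle⟩
    · exact Or.inl ⟨μ, h, hle⟩
    · refine Or.inr ⟨j, hj, ?_⟩
      have := hle j
      simp at this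
      omega
  · rintro (⟨μ, h, hle⟩ | ⟨j, hj, hne⟩)
    · exact ⟨μ, Or.inl h, hle⟩
    · refine ⟨_, Or.inr ⟨j, hj, rfl⟩, ?_⟩
      rw [Finsupp.single_le_iff]
      omega

lemma sat_iff (J : Ideal (MvPolynomial (Fin n) K)) (f : MvPolynomial (Fin n) K) :
    f ∈ satSet J ↔ ∀ j : Fin n, ∃ t : ℕ, X j ^ t * f ∈ J := by
  constructor
  · rintro ⟨s, hs⟩ j
    exact ⟨s, hs _ (Ideal.pow_mem_pow (Ideal.subset_span (Set.mem_range_self j) : X j ∈ mxI n K) s)⟩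
  · intro h
    let L : Ideal (MvPolynomial (Fin n) K) :=
      Submodule.comap (LinearMap.mulRight (MvPolynomial (Fin n) K) f) J
    have hL : ∀ g, g ∈ L ↔ g * f ∈ J := fun g => Iff.rfl
    have hle : mxI n K ≤ L.radical := by
      rw [mxI, Ideal.span_le]
      rintro _ ⟨j, rfl⟩
      obtain ⟨t, ht⟩ := h j
      exact ⟨t, (hL _).2 ht⟩
    obtain ⟨s, hs⟩ := Ideal.exists_pow_le_of_le_radical_of_fg hle
      (IsNoetherian.noetherian _)
    exact ⟨s, fun g hg => (hL g).1 (hs hg)⟩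

lemma Xpow_mul_mem {J : Ideal (MvPolynomial (Fin n) K)} (hJ : IsMonIdeal J) (j : Fin n) (t : ℕ)
    (f : MvPolynomial (Fin n) K) :
    X j ^ t * f ∈ J ↔ ∀ ν ∈ f.support, monomial (ν + Finsupp.single j t) (1 : K) ∈ J := by
  rw [mem_iff hJ]
  have hc : ∀ ν, coeff (Finsupp.single j t + ν) (X j ^ t * f) = coeff ν f := fun ν => by
    rw [X_pow_eq_monomial, coeff_monomial_mul, one_mul]
  constructor
  · intro h ν hν
    rw [add_comm]
    apply h
    rw [mem_support_iff, hc]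
    exact mem_support_iff.mp hν
  · intro h ν hν
    rw [mem_support_iff, X_pow_eq_monomial, coeff_monomial_mul'] at hν
    split_ifs at hν with hle
    · have := h (ν - Finsupp.single j t) (by rw [mem_support_iff]; simpa using hν)
      rwa [tsub_add_cancel_of_le hle] at this
    · exact absurd rfl hν

lemma forward {I : Ideal (MvPolynomial (Fin n) K)} (hI : IsMonIdeal I)
    (hq : QuasiStable I) (k : Fin n) (f : MvPolynomial (Fin n) K)
    (hf : X k * f ∈ satSet (Jk I k)) : f ∈ satSet (Jk I k) := by
  classical
  obtain ⟨H, hfin, hspan, hex⟩ := hq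
  rw [sat_iff] at hf ⊢
  obtain ⟨s, hs⟩ := hf k
  rw [← mul_assoc, ← pow_succ, Xpow_mul_mem (Jk_mon hI k)] at hs
  intro j
  have : ∀ ν ∈ f.support, ∃ t, monomial (ν + Finsupp.single j t) (1 : K) ∈ Jk I k := by
    intro ν hν
    rcases lt_or_ge j k with hjk | hjk
    · exact ⟨1, (Jk_mem hI _ _).2 (Or.inr ⟨j, hjk, by simp⟩)⟩
    rcases (Jk_mem hI _ _).1 (hs ν hν) with h | ⟨l, hl, hne⟩
    · rcases hjk.lt_or_eq with hlt | rfl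
      swap
      · exact ⟨s + 1, hs ν hν⟩
      obtain ⟨B, hB⟩ : ∃ B, ∀ μ ∈ hfin.toFinset, μ j ≤ B :=
        ⟨∑ μ ∈ hfin.toFinset, μ j, fun μ hμ =>
          Finset.single_le_sum (f := fun μ : Fin n →₀ ℕ => μ j) (fun _ _ => Nat.zero_le _) hμ⟩
      have hm : monomial (ν + Finsupp.single k (s+1) + Finsupp.single j (B+1)) (1 : K) ∈ I :=
        upper I (le_self_add) h
      obtain ⟨μ, ⟨hμ, hle, hd⟩, -⟩ := hex _ hm
      have hBμ := hB μ (by simpa using hμ)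
      have hjc : (j : ℕ) ≤ cls μ := by
        apply hd
        simp [hlt.ne]
        omega
      have hμk : μ k = 0 := by
        by_contra hne
        have : cls μ ≤ k := Nat.sInf_le ⟨k.2, hne⟩
        rw [Fin.lt_def] at hlt
        omega
      have hμI : monomial μ (1 : K) ∈ I := by
        rw [hspan]; exact Ideal.subset_span ⟨μ, hμ, rfl⟩
      refine ⟨B + 1, (Jk_mem hI _ _).2 (Or.inl (upper I ?_ hμI))⟩
      intro i
      have hi := hle i
      by_cases hik : i = k
      · subst hik; rw [hμk]; exact Nat.zero_le _
      · simpa [Finsupp.single_apply, Ne.symm hik] using hi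
    · refine ⟨0, (Jk_mem hI _ _).2 (Or.inr ⟨l, hl, ?_⟩)⟩
      have : l ≠ k := fun e => by subst e; omega
      simpa [Finsupp.single_apply, this.symm] using hne
  choose! t ht using this
  refine ⟨∑ ν ∈ f.support, t ν, (Xpow_mul_mem (Jk_mon hI k) _ _ _).2 fun ν hν => ?_⟩
  refine upper (Jk I k) ?_ (ht ν hν)
  gcongr
  exact Finset.single_le_sum (f := t) (fun _ _ => Nat.zero_le _) hν

lemma cond_trunc {I : Ideal (MvPolynomial (Fin n) K)} (hI : IsMonIdeal I) (m : ℕ)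
    (hc : ∀ k : Fin n, (k : ℕ) < m → ∀ f : MvPolynomial (Fin n) K,
      X k * f ∈ satSet (Jk I k) → f ∈ satSet (Jk I k))
    (ν : Fin n →₀ ℕ) (hν : monomial ν (1 : K) ∈ I) (j : Fin n) (hj : m ≤ j) :
    ∃ s : ℕ, monomial (trunc m ν + Finsupp.single j s) (1 : K) ∈ I := by
  induction m with
  | zero =>
    refine ⟨0, upper I ?_ hν⟩
    intro i; simp [trunc_apply]
  | succ m ih =>
    obtain ⟨s, hs⟩ := ih (fun k hk => hc k (by omega)) (by omega)
    have hmn : m < n := by have := j.2; omega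
    let k : Fin n := ⟨m, hmn⟩
    have hpow : ∀ (a : ℕ) (f : MvPolynomial (Fin n) K),
        X k ^ a * f ∈ satSet (Jk I k) → f ∈ satSet (Jk I k) := by
      intro a
      induction a with
      | zero => intro f hf; simpa using hf
      | succ a iha =>
        intro f hf
        rw [pow_succ, mul_assoc] at hf
        exact hc k (Nat.lt_succ_self m) f (iha _ hf)
    have h1 : X k ^ (ν k) * monomial (trunc (m+1) ν + Finsupp.single j s) (1 : K) ∈
        satSet (Jk I k) := by
      refine ⟨0, fun g _ => Ideal.mul_mem_left _ _ ?_⟩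
      rw [X_pow_eq_monomial, monomial_mul, one_mul]
      refine (Jk_mem hI _ _).2 (Or.inl (upper I ?_ hs))
      intro i
      simp only [Finsupp.add_apply, trunc_apply, Finsupp.single_apply, k]
      by_cases hi : (⟨m, hmn⟩ : Fin n) = i
      · subst hi; simp
      · have : (i : ℕ) ≠ m := fun e => hi (Fin.ext e.symm)
        rw [if_neg hi]
        split_ifs <;> omega
    obtain ⟨t, ht⟩ := (sat_iff _ _).1 (hpow _ _ h1) j
    rw [X_pow_eq_monomial, monomial_mul, one_mul] at ht
    rcases (Jk_mem hI _ _).1 ht with h | ⟨l, hl, hne⟩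
    · refine ⟨t + s, ?_⟩
      rw [Finsupp.single_add]
      convert h using 2
      abel_nf
    · exfalso
      have hl' : (l : ℕ) < m := hl
      have hjl : j ≠ l := fun e => by subst e; omega
      apply hne
      simp [trunc_apply, Finsupp.single_apply, hjl]
      omega

lemma dim_bound {I : Ideal (MvPolynomial (Fin n) K)} (hI : IsMonIdeal I) (A : Finset (Fin n))
    (hA : ∀ ν : Fin n →₀ ℕ, monomial ν (1 : K) ∈ I → ∃ i, i ∉ A ∧ ν i ≠ 0) :
    ((A.card : ℕ) : WithBot ℕ∞) ≤ ringKrullDim (MvPolynomial (Fin n) K ⧸ I) := by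
  have hinj : Function.Injective (Subtype.val : A → Fin n) := Subtype.val_injective
  let φ : MvPolynomial (Fin n) K →+* MvPolynomial A K := (killCompl (R := K) hinj).toRingHom
  have hker : ∀ a ∈ I, φ a = 0 := by
    obtain ⟨S, hS⟩ := hI
    have : I ≤ RingHom.ker φ := by
      conv_lhs => rw [hS]
      rw [Ideal.span_le]
      rintro _ ⟨μ, hμ, rfl⟩
      obtain ⟨i, hi, hne⟩ := hA μ (by rw [hS]; exact Ideal.subset_span ⟨μ, hμ, rfl⟩)
      exact killCompl_monomial_eq_zero_of_notMem_range hinj 1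
        (Finsupp.mem_support_iff.mpr hne) (by simpa using hi)
    exact fun a ha => this ha
  have hsurj : Function.Surjective (Ideal.Quotient.lift I φ hker) := by
    intro p
    exact ⟨Ideal.Quotient.mk I (rename Subtype.val p), killCompl_rename_app hinj p⟩
  have := ringKrullDim_le_of_surjective _ hsurj
  rw [MvPolynomial.ringKrullDim_of_isNoetherianRing, ringKrullDim_eq_zero_of_field] at this
  simpa using this

lemma backward {I : Ideal (MvPolynomial (Fin n) K)} (hI : IsMonIdeal I) (hIT : I ≠ ⊤)
    (D : ℕ) (hD : ringKrullDim (MvPolynomial (Fin n) K ⧸ I) = (D : WithBot (WithTop ℕ)))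
    (hc : ∀ k : Fin n, (k : ℕ) < D → ∀ f : MvPolynomial (Fin n) K,
      X k * f ∈ satSet (Jk I k) → f ∈ satSet (Jk I k)) : QuasiStable I := by
  classical
  have h0 : (0 : Fin n →₀ ℕ) ∉ {ν : Fin n →₀ ℕ | monomial ν (1 : K) ∈ I} := by
    intro h
    exact hIT ((Ideal.eq_top_iff_one I).2 h)
  have hpure : ∀ j : Fin n, D ≤ j → ∃ s, monomial (Finsupp.single j s) (1 : K) ∈ I := by
    intro j hj
    let A : Finset (Fin n) := insert j (Finset.univ.filter fun i : Fin n => (i : ℕ) < D)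
    have hcard : A.card = D + 1 := by
      rw [Finset.card_insert_of_notMem (by simpa using hj), Fin.card_filter_val_lt,
        min_eq_right (by have := j.2; omega)]
    have hnot : ¬ ∀ ν : Fin n →₀ ℕ, monomial ν (1 : K) ∈ I → ∃ i, i ∉ A ∧ ν i ≠ 0 := by
      intro hA
      have h1 := dim_bound hI A hA
      rw [hD, hcard] at h1
      have h2 : D + 1 ≤ D := by
        have h3 : ((D + 1 : ℕ) : ℕ∞) ≤ (D : ℕ∞) := WithBot.coe_le_coe.mp h1
        exact_mod_cast h3
      omega
    push Not at hnot
    obtain ⟨ν, hν, hνA⟩ := hnot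
    obtain ⟨s, hs⟩ := cond_trunc hI D hc ν hν j hj
    refine ⟨ν j + s, upper I ?_ hs⟩
    intro i
    simp only [Finsupp.add_apply, trunc_apply, Finsupp.single_apply]
    by_cases hij : j = i
    · subst hij; simp [hj]
    · rw [if_neg hij, if_neg hij]
      split_ifs with h
      · rw [hνA i (by simp [A, Ne.symm hij, h])]; exact le_rfl
      · simp
  have hQ : ∀ ν ∈ {ν : Fin n →₀ ℕ | monomial ν (1 : K) ∈ I}, ∀ j : Fin n,
      ∃ s : ℕ, trunc j ν + Finsupp.single j s ∈ {ν : Fin n →₀ ℕ | monomial ν (1 : K) ∈ I} := by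
    intro ν hν j
    rcases lt_or_ge (j : ℕ) D with h | h
    · exact cond_trunc hI j (fun k hk => hc k (hk.trans h)) ν hν j le_rfl
    · obtain ⟨s, hs⟩ := hpure j h
      exact ⟨s, upper I le_add_self hs⟩
  refine ⟨HB {ν | monomial ν (1 : K) ∈ I}, HB_finite (upper I) h0 hQ, ?_, ?_⟩
  · apply le_antisymm
    · intro f hf
      rw [mem_ideal_span_monomial_image]
      intro ν hν
      obtain ⟨μ, hμ, hd⟩ := exists_inv h0 ν ((mem_iff hI f).1 hf ν hν)
      exact ⟨μ, hμ, hd.1⟩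
    · rw [Ideal.span_le]
      rintro _ ⟨μ, hμ, rfl⟩
      exact hμ.1
  · intro ν hν
    obtain ⟨μ, hμ, hd⟩ := exists_inv h0 ν hν
    refine ⟨μ, ⟨hμ, hd⟩, fun μ' ⟨hμ', hd'⟩ => ?_⟩
    rcases le_total (cls μ) (cls μ') with h | h
    · exact (uniq_aux (upper I) h0 hμ hμ' hd hd' h).symm
    · exact uniq_aux (upper I) h0 hμ' hμ hd' hd h

end QS

/-- Thm. 3.4 (i)⇔(ii): a monomial ideal `I` with `D = dim P/I` is
quasi-stable iff `x_1` is a nonzerodivisor on `P/I^sat` and, for `1 ≤ k < D`, the variable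
`x_{k+1}` is a nonzerodivisor on `P/⟨I,x_1,…,x_k⟩^sat`.  (0-based: the index `k` with
`k = 0 ∨ k < D` handles both conditions uniformly.) -/
theorem statement8 {n : ℕ} {K : Type*} [Field K]
    (I : Ideal (MvPolynomial (Fin n) K)) (hImon : IsMonIdeal I) (hI0 : I ≠ ⊥) (hIT : I ≠ ⊤)
    (D : ℕ) (hD : ringKrullDim (MvPolynomial (Fin n) K ⧸ I) = (D : WithBot (WithTop ℕ))) :
    QuasiStable I ↔
      ∀ k : Fin n, ((k : ℕ) = 0 ∨ (k : ℕ) < D) →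
        ∀ f : MvPolynomial (Fin n) K,
          X k * f ∈ satSet (I ⊔ Ideal.span {p | ∃ j : Fin n, (j : ℕ) < (k : ℕ) ∧ p = X j}) →
          f ∈ satSet (I ⊔ Ideal.span {p | ∃ j : Fin n, (j : ℕ) < (k : ℕ) ∧ p = X j}) := by
  exact ⟨fun hq k _ f hf => QS.forward hImon hq k f hf,
    fun h => QS.backward hImon hIT D hD fun k hk f hf => h k (Or.inr hk) f hf⟩
end

section
/- Let I be a proper nonzero monomial ideal of P and D the Krull dimension of P/I. Then I is quasi-stable if and only if the chain of inclusions I : x_1^∞ ⊆ I : x_2^∞ ⊆ ⋯ ⊆ I : x_D^∞ holds and for every D < k ≤ n there exists an exponent e_k ≥ 1 such that x_k^{e_k} ∈ I. -/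
open MvPolynomial

theorem zero_of_lt_cls {n : ℕ} (μ : Fin n →₀ ℕ) (j : Fin n) (h : (j : ℕ) < cls μ) : μ j = 0 := by
  by_contra h0
  have : cls μ ≤ (j : ℕ) := Nat.sInf_le ⟨j.2, h0⟩
  omega

theorem cls_spec {n : ℕ} (μ : Fin n →₀ ℕ) (h : μ ≠ 0) : ∃ c : Fin n, cls μ = c ∧ μ c ≠ 0 := by
  obtain ⟨i, hi⟩ := Finsupp.ne_iff.mp h
  have hne : {i : ℕ | ∃ hi : i < n, μ ⟨i, hi⟩ ≠ 0}.Nonempty := ⟨i, i.2, hi⟩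
  obtain ⟨hc, hc'⟩ := Nat.sInf_mem hne
  exact ⟨⟨_, hc⟩, rfl, hc'⟩

theorem cls_le {n : ℕ} (μ : Fin n →₀ ℕ) (j : Fin n) (h : μ j ≠ 0) : cls μ ≤ j :=
  Nat.sInf_le ⟨j.2, h⟩

theorem exists_bound {n : ℕ} (H : Set (Fin n →₀ ℕ)) (hH : H.Finite) :
    ∃ B : ℕ, ∀ μ ∈ H, ∀ j, μ j ≤ B := by
  obtain ⟨b, hb⟩ := hH.bddAbove
  exact ⟨Finset.univ.sup b, fun μ hμ j => (hb hμ j).trans (Finset.le_sup (Finset.mem_univ j))⟩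

theorem exists_gens {n : ℕ} (U : Set (Fin n →₀ ℕ)) :
    ∃ G : Set (Fin n →₀ ℕ), G.Finite ∧ G ⊆ U ∧ ∀ u ∈ U, ∃ g ∈ G, g ≤ u := by
  refine ⟨{x | Minimal (· ∈ U) x},
    WellQuasiOrderedLE.finite_of_isAntichain (setOfPred_minimal_antichain _),
    fun x hx => hx.prop, fun u hu => ?_⟩
  obtain ⟨g, h1, h2⟩ := exists_minimal_le_of_wellFoundedLT (· ∈ U) u hu
  exact ⟨g, h2, h1⟩

/-- Uniform exchange property. -/
def Exch {n : ℕ} (M : Set (Fin n →₀ ℕ)) (B : ℕ) : Prop :=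
  ∀ i j : Fin n, i < j → ∀ ν s, ν + Finsupp.single i s ∈ M → ν + Finsupp.single j B ∈ M

theorem exch_of_local {n : ℕ} (M : Set (Fin n →₀ ℕ)) (hM : IsUpperSet M)
    (h : ∀ i j : Fin n, i < j → ∀ ν s, ν + Finsupp.single i s ∈ M →
      ∃ t, ν + Finsupp.single j t ∈ M) : ∃ B, Exch M B := by
  have key : ∀ i j : Fin n, ∃ B, i < j → ∀ ν s, ν + Finsupp.single i s ∈ M →
      ν + Finsupp.single j B ∈ M := by
    intro i j
    by_cases hij : i < j
    · obtain ⟨G, hG, hGU, hGm⟩ := exists_gens {ν | ∃ s, ν + Finsupp.single i s ∈ M}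
      have : ∀ g : Fin n →₀ ℕ, ∃ t, g ∈ G → g + Finsupp.single j t ∈ M := by
        intro g
        by_cases hg : g ∈ G
        · obtain ⟨s, hs⟩ := hGU hg
          obtain ⟨t, ht⟩ := h i j hij g s hs
          exact ⟨t, fun _ => ht⟩
        · exact ⟨0, fun h => absurd h hg⟩
      choose t ht using this
      obtain ⟨b, hb⟩ := (hG.image t).bddAbove
      refine ⟨b, fun _ ν s hs => ?_⟩
      obtain ⟨g, hg, hgν⟩ := hGm ν ⟨s, hs⟩
      exact hM (add_le_add hgν (Finsupp.single_le_single.2 (hb ⟨g, hg, rfl⟩))) (ht g hg)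
    · exact ⟨0, fun h => absurd h hij⟩
  choose B hB using key
  refine ⟨Finset.univ.sup fun i => Finset.univ.sup (B i), fun i j hij ν s hs => ?_⟩
  refine hM (add_le_add le_rfl (Finsupp.single_le_single.2 ?_)) (hB i j hij ν s hs)
  exact (Finset.le_sup (f := B i) (Finset.mem_univ j)).trans
    (Finset.le_sup (f := fun i => Finset.univ.sup (B i)) (Finset.mem_univ i))

theorem exch_of_pb {n : ℕ} (M H : Set (Fin n →₀ ℕ)) (hM : IsUpperSet M) (hH : H.Finite)
    (hHM : H ⊆ M) (hd : ∀ ν ∈ M, ∃ μ ∈ H, InvDiv μ ν) : ∃ B, Exch M B := by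
  obtain ⟨B, hB⟩ := exists_bound H hH
  refine ⟨B + 1, fun i j hij ν s hs => ?_⟩
  obtain ⟨μ, hμ, hle, hcl⟩ := hd (ν + Finsupp.single i s + Finsupp.single j (B + 1))
    (hM le_self_add hs)
  have h1 := hB μ hμ j
  have h2 := hcl j (by simp only [Finsupp.add_apply, Finsupp.single_eq_same]; omega)
  have h3 := zero_of_lt_cls μ i (lt_of_lt_of_le hij h2)
  refine hM (fun k => ?_) (hHM hμ)
  have h4 := hle k
  by_cases hk : k = i
  · subst hk; simp [h3]
  · simp only [Finsupp.add_apply] at h4 ⊢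
    rw [Finsupp.single_apply (a := i), if_neg (Ne.symm hk)] at h4
    simpa using h4

/-- The candidate Pommaret basis. -/
def PBset {n : ℕ} (M : Set (Fin n →₀ ℕ)) : Set (Fin n →₀ ℕ) :=
  {μ | μ ∈ M ∧ ∀ c : Fin n, cls μ = c → μ - Finsupp.single c 1 ∉ M}

theorem pbset_finite {n : ℕ} (M : Set (Fin n →₀ ℕ)) (hM : IsUpperSet M) (h0 : (0 : Fin n →₀ ℕ) ∉ M)
    (B : ℕ) (hB : Exch M B) : (PBset M).Finite := by
  obtain ⟨G, hG, hGM, hGm⟩ := exists_gens M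
  obtain ⟨A, hA⟩ := exists_bound G hG
  refine (Set.finite_Iic (Finsupp.equivFunOnFinite.symm (fun _ : Fin n => A + B))).subset ?_
  rintro μ ⟨hμ, hμc⟩ j
  simp only [Finsupp.equivFunOnFinite_symm_apply_apply]
  obtain ⟨c, hc, hc0⟩ := cls_spec μ (fun h => h0 (h ▸ hμ))
  specialize hμc c hc
  obtain ⟨g, hg, hgμ⟩ := hGm μ hμ
  have hgj := hA g hg j
  rcases lt_trichotomy j c with hj | rfl | hj
  · rw [zero_of_lt_cls μ j (by rw [hc]; exact hj)]; omega
  · by_contra hlt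
    apply hμc
    refine hM (fun k => ?_) (hGM hg)
    have := hgμ k
    by_cases hk : j = k
    · subst hk; simp only [Finsupp.tsub_apply, Finsupp.single_eq_same]; omega
    · simp only [Finsupp.tsub_apply, Finsupp.single_apply, if_neg hk]; omega
  · by_contra hlt
    apply hμc
    have hcj : c ≠ j := hj.ne
    refine hM (fun k => ?_) (hB c j hj (μ - Finsupp.single c 1 - Finsupp.single j (μ j - A)) 1
      (hM (fun k => ?_) (hGM hg)))
    · simp only [Finsupp.tsub_apply, Finsupp.add_apply, Finsupp.single_apply]
      by_cases h1 : c = k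
      · subst h1; simp [hcj.symm]
      · by_cases h2 : j = k
        · subst h2; simp [hcj]; omega
        · simp [h1, h2]
    · have := hgμ k
      have hAk := hA g hg k
      simp only [Finsupp.tsub_apply, Finsupp.add_apply, Finsupp.single_apply]
      by_cases h1 : c = k
      · subst h1; simp [hcj.symm]; omega
      · by_cases h2 : j = k
        · subst h2; simp [hcj]; omega
        · simp [h1, h2]; omega

theorem pbset_exists {n : ℕ} (M : Set (Fin n →₀ ℕ)) (h0 : (0 : Fin n →₀ ℕ) ∉ M)
    (ν : Fin n →₀ ℕ) : ν ∈ M → ∃ μ ∈ PBset M, InvDiv μ ν := by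
  induction ν using WellFoundedLT.induction with
  | ind ν ih =>
  intro hν
  by_cases h : ν ∈ PBset M
  · exact ⟨ν, h, le_rfl, fun j hj => absurd rfl hj⟩
  · simp only [PBset, Set.mem_ofPred_eq, not_and, not_forall, not_not] at h
    obtain ⟨c, hc, hcM⟩ := h hν
    obtain ⟨c', hc', hc0⟩ := cls_spec ν (fun h => h0 (h ▸ hν))
    obtain rfl : c = c' := Fin.ext (hc.symm.trans hc')
    have hle : ν - Finsupp.single c 1 ≤ ν := tsub_le_self
    have hlt : ν - Finsupp.single c 1 < ν := by
      refine lt_of_le_of_ne hle fun he => ?_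
      have := DFunLike.congr_fun he c
      simp at this; omega
    obtain ⟨μ, hμ, hμle, hμc⟩ := ih _ hlt hcM
    refine ⟨μ, hμ, hμle.trans hle, fun j hj => ?_⟩
    by_cases hjc : c = j
    · subst hjc
      obtain ⟨d, hd, hd0⟩ := cls_spec μ (fun h => h0 (h ▸ hμ.1))
      rw [hd, ← hc]
      refine cls_le ν d ?_
      have := hμle.trans hle d
      omega
    · apply hμc
      simpa [Finsupp.single_apply, hjc] using hj

theorem pbset_unique_aux {n : ℕ} (M : Set (Fin n →₀ ℕ)) (hM : IsUpperSet M)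
    (h0 : (0 : Fin n →₀ ℕ) ∉ M) (ν μ μ' : Fin n →₀ ℕ) (hμ : μ ∈ PBset M) (hμ' : μ' ∈ PBset M)
    (h : InvDiv μ ν) (h' : InvDiv μ' ν) (c : Fin n) (hc : cls μ' = c) (hle : cls μ' ≤ cls μ)
    (hlt : μ c < μ' c) : False := by
  refine hμ'.2 c hc (hM (fun k => ?_) hμ.1)
  simp only [Finsupp.tsub_apply, Finsupp.single_apply]
  by_cases hk : c = k
  · subst hk; simp; omega
  · simp only [if_neg hk, tsub_zero]
    rcases lt_or_gt_of_ne hk with hk | hk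
    · have : ν k = μ' k := by
        by_contra hne
        have := h'.2 k hne
        rw [hc] at this
        exact absurd hk (not_lt.2 this)
      exact this ▸ h.1 k
    · rw [zero_of_lt_cls μ k (lt_of_lt_of_le (by rw [hc]; exact hk) hle)]
      exact Nat.zero_le _

theorem pbset_unique {n : ℕ} (M : Set (Fin n →₀ ℕ)) (hM : IsUpperSet M)
    (h0 : (0 : Fin n →₀ ℕ) ∉ M) (ν μ μ' : Fin n →₀ ℕ) (hμ : μ ∈ PBset M) (hμ' : μ' ∈ PBset M)
    (h : InvDiv μ ν) (h' : InvDiv μ' ν) : μ = μ' := by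
  obtain ⟨c, hc, hc0⟩ := cls_spec μ (fun h => h0 (h ▸ hμ.1))
  obtain ⟨c', hc', hc0'⟩ := cls_spec μ' (fun h => h0 (h ▸ hμ'.1))
  rcases lt_trichotomy (cls μ) (cls μ') with hl | he | hl
  · exact (pbset_unique_aux M hM h0 ν μ' μ hμ' hμ h' h c hc hl.le
      (by rw [zero_of_lt_cls μ' c (by omega)]; omega)).elim
  · obtain rfl : c = c' := Fin.ext (by omega)
    rcases lt_trichotomy (μ c) (μ' c) with hl | hcc | hl
    · exact (pbset_unique_aux M hM h0 ν μ μ' hμ hμ' h h' c hc' he.ge hl).elim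
    · ext k
      rcases lt_trichotomy k c with hk | rfl | hk
      · have hk' : (k : ℕ) < c := hk
        rw [zero_of_lt_cls μ k (by omega), zero_of_lt_cls μ' k (by omega)]
      · exact hcc
      · have hk' : (c : ℕ) < k := hk
        have a1 : ν k = μ k := by
          by_contra hne
          have := h.2 k hne
          omega
        have a2 : ν k = μ' k := by
          by_contra hne
          have := h'.2 k hne
          omega
        omega
    · exact (pbset_unique_aux M hM h0 ν μ' μ hμ' hμ h' h c hc he.le hl).elim
  · exact (pbset_unique_aux M hM h0 ν μ μ' hμ hμ' h h' c' hc' hl.le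
      (by rw [zero_of_lt_cls μ c' (by omega)]; omega)).elim

theorem exch_power {n : ℕ} (M : Set (Fin n →₀ ℕ)) (B : ℕ) (hB : Exch M B) (k : Fin n)
    (ν : Fin n →₀ ℕ) (hν : ν ∈ M) (hk : ∀ j, k < j → ν j = 0) :
    ∃ e, Finsupp.single k e ∈ M := by
  have key : ∀ m : ℕ, m ≤ k → ∃ ν ∈ M, (∀ j, k < j → ν j = 0) ∧ ∀ j : Fin n, (j : ℕ) < m → ν j = 0 := by
    intro m
    induction m with
    | zero => exact fun _ => ⟨ν, hν, hk, fun j hj => absurd hj (Nat.not_lt_zero _)⟩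
    | succ m ih =>
      intro hm
      obtain ⟨ν, hν, h1, h2⟩ := ih (by omega)
      let i : Fin n := ⟨m, by omega⟩
      have hik : i < k := hm
      refine ⟨ν.erase i + Finsupp.single k B, hB i k hik _ (ν i) ?_, ?_, ?_⟩
      · rwa [Finsupp.erase_add_single]
      · intro j hj
        have : j ≠ i := (hik.trans hj).ne'
        simp [Finsupp.erase_ne this, h1 j hj, hj.ne']
      · intro j hj
        have hjk : j < k := Fin.lt_def.2 (by omega)
        by_cases hji : j = i
        · subst hji; simp [hjk.ne]
        · have : (j : ℕ) ≠ m := fun h => hji (Fin.ext h)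
          simp [Finsupp.erase_ne hji, h2 j (by omega), hjk.ne]
  obtain ⟨ν, hν, h1, h2⟩ := key k le_rfl
  refine ⟨ν k, ?_⟩
  convert hν using 1
  ext j
  rcases lt_trichotomy j k with hj | rfl | hj
  · simp [h2 j hj, hj.ne]
  · simp
  · simp [h1 j hj, hj.ne']

theorem mem_iff_mon {n : ℕ} {K : Type*} [Field K] (I : Ideal (MvPolynomial (Fin n) K))
    (hI : IsMonIdeal I) (f : MvPolynomial (Fin n) K) :
    f ∈ I ↔ ∀ ν ∈ f.support, monomial ν (1 : K) ∈ I := by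
  obtain ⟨S, rfl⟩ := hI
  rw [mem_ideal_span_monomial_image]
  refine forall₂_congr fun ν _ => ?_
  rw [mem_ideal_span_monomial_image]
  simp [support_monomial]

theorem dim_bound {n : ℕ} {K : Type*} [Field K] (I : Ideal (MvPolynomial (Fin n) K))
    (hI : IsMonIdeal I) (k : Fin n)
    (h : ∀ ν : Fin n →₀ ℕ, monomial ν (1 : K) ∈ I → ∃ j, k < j ∧ ν j ≠ 0) :
    ((k + 1 : ℕ) : WithBot ℕ∞) ≤ ringKrullDim (MvPolynomial (Fin n) K ⧸ I) := by
  have hinj : Function.Injective (Fin.castLE (Nat.succ_le_of_lt k.2)) := Fin.castLE_injective _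
  have hker : ∀ f ∈ I, (killCompl (R := K) hinj).toRingHom f = 0 := by
    intro f hf
    obtain ⟨S, hS⟩ := id hI
    have : I ≤ RingHom.ker (killCompl (R := K) hinj).toRingHom := by
      conv_lhs => rw [hS]
      rw [Ideal.span_le]
      rintro _ ⟨ν, hν, rfl⟩
      obtain ⟨j, hj, hj0⟩ := h ν (by rw [hS]; exact Ideal.subset_span ⟨ν, hν, rfl⟩)
      simp only [SetLike.mem_coe, RingHom.mem_ker, AlgHom.toRingHom_eq_coe, RingHom.coe_coe]
      rw [killCompl, aeval_monomial, Finsupp.prod]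
      refine mul_eq_zero_of_right _ (Finset.prod_eq_zero (Finsupp.mem_support_iff.2 hj0) ?_)
      rw [dif_neg, zero_pow hj0]
      rintro ⟨a, ha⟩
      have h1 : (j : ℕ) = a := by rw [← ha]; rfl
      have h2 : (k : ℕ) < j := hj
      have := a.2
      omega
    exact this hf
  have hs : Function.Surjective (Ideal.Quotient.lift I (killCompl (R := K) hinj).toRingHom hker) := by
    apply Ideal.Quotient.lift_surjective_of_surjective
    intro p
    exact ⟨rename _ p, killCompl_rename_app hinj p⟩
  have := ringKrullDim_le_of_surjective _ hs
  rwa [MvPolynomial.ringKrullDim_of_isNoetherianRing, ringKrullDim_eq_zero_of_field, zero_add,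
    Nat.card_eq_fintype_card, Fintype.card_fin] at this

theorem X_mul_mem {n : ℕ} {K : Type*} [Field K] (I : Ideal (MvPolynomial (Fin n) K))
    (hI : IsMonIdeal I) (f : MvPolynomial (Fin n) K) (i : Fin n) (s : ℕ) :
    X i ^ s * f ∈ I ↔ ∀ ν ∈ f.support, monomial (ν + Finsupp.single i s) (1 : K) ∈ I := by
  rw [mem_iff_mon I hI, X_pow_eq_monomial]
  constructor
  · intro h ν hν
    refine h _ ?_
    rw [add_comm, mem_support_iff, coeff_monomial_mul, one_mul]
    exact mem_support_iff.1 hν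
  · intro h ν hν
    rw [mem_support_iff, coeff_monomial_mul'] at hν
    split_ifs at hν with hle
    · rw [one_mul] at hν
      have := h _ (mem_support_iff.2 hν)
      rwa [tsub_add_cancel_of_le hle] at this
    · exact absurd rfl hν

theorem statement9 {n : ℕ} {K : Type*} [Field K]
    (I : Ideal (MvPolynomial (Fin n) K)) (hImon : IsMonIdeal I) (hI0 : I ≠ ⊥) (hIT : I ≠ ⊤)
    (D : ℕ) (hD : ringKrullDim (MvPolynomial (Fin n) K ⧸ I) = (D : WithBot (WithTop ℕ))) :
    QuasiStable I ↔
      ((∀ i j : Fin n, (i : ℕ) ≤ (j : ℕ) → (j : ℕ) < D →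
          {f : MvPolynomial (Fin n) K | ∃ s : ℕ, X i ^ s * f ∈ I} ⊆
            {f : MvPolynomial (Fin n) K | ∃ s : ℕ, X j ^ s * f ∈ I}) ∧
        (∀ k : Fin n, D ≤ (k : ℕ) → ∃ e : ℕ, 1 ≤ e ∧ X k ^ e ∈ I)) := by
  set M : Set (Fin n →₀ ℕ) := {ν | monomial ν (1 : K) ∈ I} with hMdef
  have hMm : ∀ ν, ν ∈ M ↔ monomial ν (1 : K) ∈ I := fun ν => Iff.rfl
  have hM : IsUpperSet M := by
    intro a b hab ha
    have : monomial b (1 : K) = monomial (b - a) 1 * monomial a 1 := by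
      rw [monomial_mul, tsub_add_cancel_of_le hab, one_mul]
    rw [hMm, this]
    exact I.mul_mem_left _ ha
  have h0 : (0 : Fin n →₀ ℕ) ∉ M := fun h => hIT ((Ideal.eq_top_iff_one I).2 h)
  constructor
  · rintro ⟨H, hfin, hspan, huniq⟩
    obtain ⟨B, hB⟩ := exch_of_pb M H hM hfin
      (fun μ hμ => by rw [hMm, hspan]; exact Ideal.subset_span ⟨μ, hμ, rfl⟩)
      (fun ν hν => by
        obtain ⟨μ, hμ, -⟩ := huniq ν hν
        exact ⟨μ, hμ.1, hμ.2⟩)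
    refine ⟨?_, ?_⟩
    · intro i j hij _ f
      rcases eq_or_lt_of_le (show i ≤ j from hij) with rfl | hij
      · exact id
      · rintro ⟨s, hs⟩
        refine ⟨B, ?_⟩
        rw [X_mul_mem I hImon] at hs ⊢
        exact fun ν hν => hB i j hij ν s (hs ν hν)
    · intro k hk
      by_contra hne
      have hb := dim_bound I hImon k (fun ν hν => by
        by_contra hc
        push Not at hc
        obtain ⟨e, he⟩ := exch_power M B hB k ν hν hc
        refine hne ⟨e + 1, by omega, ?_⟩
        rw [X_pow_eq_monomial]
        exact hM (Finsupp.single_le_single.2 (Nat.le_succ e)) he)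
      rw [hD] at hb
      have : (k : ℕ) + 1 ≤ D := (Nat.cast_le (α := WithBot ℕ∞)).1 hb
      omega
  · rintro ⟨h1, h2⟩
    obtain ⟨B, hB⟩ := exch_of_local M hM (by
      intro i j hij ν s hs
      by_cases hj : (j : ℕ) < D
      · obtain ⟨t, ht⟩ := h1 i j hij.le hj (a := monomial ν (1 : K))
          ⟨s, by rw [X_pow_eq_monomial, monomial_mul, one_mul, add_comm]; exact hs⟩
        refine ⟨t, ?_⟩
        rwa [X_pow_eq_monomial, monomial_mul, one_mul, add_comm] at ht
      · obtain ⟨e, -, he⟩ := h2 j (not_lt.1 hj)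
        rw [X_pow_eq_monomial] at he
        exact ⟨e, hM le_add_self he⟩)
    refine ⟨PBset M, pbset_finite M hM h0 B hB, ?_, ?_⟩
    · apply le_antisymm
      · intro f hf
        rw [mem_ideal_span_monomial_image]
        intro ν hν
        obtain ⟨μ, hμ, hd⟩ := pbset_exists M h0 ν ((mem_iff_mon I hImon f).1 hf ν hν)
        exact ⟨μ, hμ, hd.1⟩
      · rw [Ideal.span_le]
        rintro _ ⟨μ, hμ, rfl⟩
        exact hμ.1
    · intro ν hν
      obtain ⟨μ, hμ, hd⟩ := pbset_exists M h0 ν hν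
      exact ⟨μ, ⟨hμ, hd⟩, fun μ' h' => pbset_unique M hM h0 ν μ' μ h'.1 hμ h'.2 hd⟩
end

section
/- Let I be a proper nonzero monomial ideal of P. Then I is quasi-stable if and only if for all 1 ≤ k ≤ n the equality I : x_k^∞ = I : ⟨x_k, x_{k+1},…, x_n⟩^∞ holds. -/
open MvPolynomial

/-- `c` is the smallest index at which `h` does not vanish. -/
def IsC {n : ℕ} (h : Fin n →₀ ℕ) (c : Fin n) : Prop := h c ≠ 0 ∧ ∀ j < c, h j = 0

theorem IsC.cls_eq {n : ℕ} {h : Fin n →₀ ℕ} {c : Fin n} (hc : IsC h c) : cls h = c := by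
  apply le_antisymm
  · exact Nat.sInf_le ⟨c.2, hc.1⟩
  · have hne : {i : ℕ | ∃ hi : i < n, h ⟨i, hi⟩ ≠ 0}.Nonempty := ⟨c, c.2, hc.1⟩
    obtain ⟨hi, h1⟩ := Nat.sInf_mem hne
    by_contra hlt
    exact h1 (hc.2 ⟨_, hi⟩ (by rw [Fin.lt_def]; exact not_le.mp hlt))

theorem exists_isC {n : ℕ} {h : Fin n →₀ ℕ} (h0 : h ≠ 0) : ∃ c, IsC h c := by
  have hne : ({c : Fin n | h c ≠ 0}).Nonempty := by
    by_contra hh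
    apply h0
    ext i
    by_contra hi
    exact hh ⟨i, hi⟩
  obtain ⟨c, hc, hm⟩ := WellFounded.has_min (wellFounded_lt (α := Fin n)) _ hne
  refine ⟨c, hc, fun j hj => ?_⟩
  by_contra hj0
  exact hm j hj0 hj

/-- The candidate Pommaret basis. -/
def pbSet {n : ℕ} (M : Set (Fin n →₀ ℕ)) : Set (Fin n →₀ ℕ) :=
  {h | h ∈ M ∧ ∃ c, IsC h c ∧ h - Finsupp.single c 1 ∉ M}

theorem pb_exists {n : ℕ} {M : Set (Fin n →₀ ℕ)} (h0 : (0 : Fin n →₀ ℕ) ∉ M) :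
    ∀ (d : ℕ) (ν : Fin n →₀ ℕ), ν.degree = d → ν ∈ M → ∃ μ ∈ pbSet M, InvDiv μ ν := by
  intro d
  induction d using Nat.strong_induction_on with
  | _ d ih =>
    intro ν hd hν
    obtain ⟨c, hc⟩ := exists_isC (h := ν) (by rintro rfl; exact h0 hν)
    by_cases hm : ν - Finsupp.single c 1 ∈ M
    · have hle : Finsupp.single c 1 ≤ ν := by
        rw [Finsupp.single_le_iff]; exact Nat.one_le_iff_ne_zero.mpr hc.1
      have hdeg : (ν - Finsupp.single c 1).degree + 1 = ν.degree := by
        conv_rhs => rw [← tsub_add_cancel_of_le hle]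
        simp
      obtain ⟨μ, hμ, hle2, hj⟩ := ih _ (by omega) _ rfl hm
      refine ⟨μ, hμ, hle2.trans tsub_le_self, fun j hne => ?_⟩
      by_cases hjc : c = j
      · subst hjc
        obtain ⟨c', hc', -⟩ := hμ.2
        rw [hc'.cls_eq]
        by_contra hlt
        apply hc'.1
        have h1 := hle2 c'
        have h2 := hc.2 c' (by rw [Fin.lt_def]; omega)
        simp [h2] at h1
        exact h1
      · apply hj
        simpa [Finsupp.single_apply, hjc] using hne
    · exact ⟨ν, ⟨hν, c, hc, hm⟩, le_rfl, fun j hj => absurd rfl hj⟩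

theorem pb_unique {n : ℕ} {M : Set (Fin n →₀ ℕ)} (hM : IsUpperSet M) {ν h₁ h₂ : Fin n →₀ ℕ}
    (H₁ : h₁ ∈ pbSet M) (H₂ : h₂ ∈ pbSet M) (d₁ : InvDiv h₁ ν) (d₂ : InvDiv h₂ ν) : h₁ = h₂ := by
  -- key fact
  have key : ∀ a b : Fin n →₀ ℕ, a ∈ pbSet M → b ∈ pbSet M → b ≤ a → ∀ c, IsC a c →
      a c ≤ b c := by
    intro a b ha hb hba c hc
    obtain ⟨c', hc', hn⟩ := ha.2
    obtain rfl : c = c' := by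
      apply Fin.ext; rw [← hc.cls_eq, hc'.cls_eq]
    by_contra hlt
    apply hn
    refine hM ?_ hb.1
    intro j
    have := hba j
    by_cases hj : c = j
    · subst hj; simp; omega
    · simpa [Finsupp.single_apply, hj] using this
  have main : ∀ a b : Fin n →₀ ℕ, a ∈ pbSet M → b ∈ pbSet M → InvDiv a ν → InvDiv b ν →
      cls a ≤ cls b → a = b := by
    intro a b ha hb da db hab
    obtain ⟨ca, hca, -⟩ := id ha.2
    obtain ⟨cb, hcb, -⟩ := id hb.2
    rw [hca.cls_eq, hcb.cls_eq] at hab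
    have ea : ∀ j, ca < j → ν j = a j := by
      intro j hj
      by_contra hne
      have := da.2 j hne
      rw [hca.cls_eq] at this
      rw [Fin.lt_def] at hj; omega
    have eb : ∀ j, cb < j → ν j = b j := by
      intro j hj
      by_contra hne
      have := db.2 j hne
      rw [hcb.cls_eq] at this
      rw [Fin.lt_def] at hj; omega
    rcases lt_or_eq_of_le (show ca ≤ cb from hab) with hlt | heq
    · exfalso
      have hba : b ≤ a := by
        intro j
        rcases lt_or_ge ca j with h | h
        · rw [← ea j h]; exact db.1 j
        · rw [hcb.2 j (lt_of_le_of_lt h hlt)]; exact Nat.zero_le _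
      have := key a b ha hb hba ca hca
      rw [hcb.2 ca hlt] at this
      exact hca.1 (by omega)
    · subst heq
      have hoff : ∀ j, j ≠ ca → a j = b j := by
        intro j hj
        rcases lt_or_gt_of_ne hj with h | h
        · rw [hca.2 j h, hcb.2 j h]
        · rw [← ea j h, ← eb j h]
      have hat : a ca = b ca := by
        rcases le_total (a ca) (b ca) with h | h
        · refine le_antisymm h (key b a hb ha ?_ ca hcb)
          intro j
          by_cases hj : j = ca
          · subst hj; exact h
          · exact (hoff j hj).le
        · refine le_antisymm (key a b ha hb ?_ ca hca) h
          intro j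
          by_cases hj : j = ca
          · subst hj; exact h
          · exact (hoff j hj).ge
      ext j
      by_cases hj : j = ca
      · subst hj; exact hat
      · exact hoff j hj
  rcases le_total (cls h₁) (cls h₂) with h | h
  · exact main _ _ H₁ H₂ d₁ d₂ h
  · exact (main _ _ H₂ H₁ d₂ d₁ h).symm

theorem finite_of_upper_finite {n : ℕ} (S : Set (Fin n →₀ ℕ))
    (hS : ∀ h ∈ S, {h' ∈ S | h ≤ h'}.Finite) : S.Finite := by
  by_contra hinf
  let f := Set.Infinite.natEmbedding S hinf
  obtain ⟨g, hg⟩ := WellQuasiOrdered.exists_monotone_subseq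
    (wellQuasiOrdered_le (α := Fin n →₀ ℕ)) (fun m => (f m : Fin n →₀ ℕ))
  refine (Set.infinite_range_of_injective (f := fun m => (f (g m) : Fin n →₀ ℕ)) ?_).mono ?_
    (hS _ (f (g 0)).2)
  · exact Subtype.val_injective.comp (f.injective.comp g.injective)
  · rintro _ ⟨m, rfl⟩
    exact ⟨(f (g m)).2, hg 0 m (Nat.zero_le _)⟩

theorem pb_finite {n : ℕ} {M : Set (Fin n →₀ ℕ)} (hM : IsUpperSet M)
    (hD : ∀ (k i : Fin n), k ≤ i → ∀ μ s, μ + Finsupp.single k s ∈ M →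
      ∃ t, μ + Finsupp.single i t ∈ M) : (pbSet M).Finite := by
  have hsub : pbSet M ⊆ ⋃ c : Fin n, {h | h ∈ M ∧ IsC h c ∧ h - Finsupp.single c 1 ∉ M} := by
    rintro h ⟨hm, c, h1, h2⟩
    exact Set.mem_iUnion.mpr ⟨c, hm, h1, h2⟩
  refine (Set.finite_iUnion fun c => ?_).subset hsub
  apply finite_of_upper_finite
  rintro h ⟨hm, hc, hn⟩
  have hle : Finsupp.single c 1 ≤ h := by
    rw [Finsupp.single_le_iff]; exact Nat.one_le_iff_ne_zero.mpr hc.1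
  have ht : ∀ i, ∃ t, c ≤ i → h - Finsupp.single c 1 + Finsupp.single i t ∈ M := by
    intro i
    by_cases hi : c ≤ i
    · obtain ⟨t, ht⟩ := hD c i hi (h - Finsupp.single c 1) 1 (by rwa [tsub_add_cancel_of_le hle])
      exact ⟨t, fun _ => ht⟩
    · exact ⟨0, fun h => absurd h hi⟩
  choose t ht using ht
  refine (Set.finite_Iic (h + Finsupp.equivFunOnFinite.symm t)).subset ?_
  rintro h' ⟨⟨hm', hc', hn'⟩, hhh⟩
  intro i
  by_contra hlt
  have hlt : h i + t i < h' i := by simpa using hlt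
  rcases lt_trichotomy i c with hi | rfl | hi
  · rw [hc'.2 i hi] at hlt; omega
  · apply hn'
    refine hM ?_ hm
    intro j
    have := hhh j
    by_cases hj : i = j
    · subst hj; simp; omega
    · simpa [Finsupp.single_apply, hj] using this
  · apply hn'
    refine hM ?_ (ht i hi.le)
    intro j
    have := hhh j
    by_cases hj : i = j
    · subst hj
      simp [Finsupp.single_apply, hi.ne]; omega
    · simp [Finsupp.single_apply, hj]
      omega

theorem D_of_pb {n : ℕ} {M H : Set (Fin n →₀ ℕ)} (hM : IsUpperSet M) (h0 : (0 : Fin n →₀ ℕ) ∉ M)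
    (hfin : H.Finite) (hHM : H ⊆ M) (hH : ∀ ν ∈ M, ∃ μ ∈ H, InvDiv μ ν)
    (k i : Fin n) (hki : k ≤ i) (μ : Fin n →₀ ℕ) (s : ℕ) (hμ : μ + Finsupp.single k s ∈ M) :
    ∃ t, μ + Finsupp.single i t ∈ M := by
  rcases eq_or_lt_of_le hki with rfl | hlt
  · exact ⟨s, hμ⟩
  obtain ⟨B, hB⟩ := (hfin.image (fun h => h i)).bddAbove
  refine ⟨B + 1, ?_⟩
  obtain ⟨h, hh, hle, hj⟩ := hH (μ + Finsupp.single k s + Finsupp.single i (B + 1))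
    (hM le_self_add hμ)
  have hb : h i ≤ B := hB ⟨h, hh, rfl⟩
  have hi := hj i (by simp [Finsupp.single_apply, hlt.ne]; omega)
  obtain ⟨c, hc⟩ := exists_isC (h := h) (by rintro rfl; exact h0 (hHM hh))
  rw [hc.cls_eq] at hi
  refine hM ?_ (hHM hh)
  intro j
  by_cases hjk : k = j
  · subst hjk
    rw [hc.2 k (lt_of_lt_of_le hlt hi)]; exact Nat.zero_le _
  · simpa [Finsupp.single_apply, hjk] using hle j

/-- Thm. 3.4 (i)⇔(iv): a monomial ideal `I` is quasi-stable iff for all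
`k` the equality `I : x_k^∞ = I : ⟨x_k,…,x_n⟩^∞` holds. -/
theorem statement10 {n : ℕ} {K : Type*} [Field K]
    (I : Ideal (MvPolynomial (Fin n) K)) (hImon : IsMonIdeal I) (hI0 : I ≠ ⊥) (hIT : I ≠ ⊤) :
    QuasiStable I ↔
      ∀ k : Fin n,
        {f : MvPolynomial (Fin n) K | ∃ s : ℕ, X k ^ s * f ∈ I} =
        {f : MvPolynomial (Fin n) K | ∃ s : ℕ,
          ∀ g ∈ ((Ideal.span {p | ∃ i : Fin n, k ≤ i ∧ p = X i}) ^ s :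
            Ideal (MvPolynomial (Fin n) K)), g * f ∈ I} := by
  obtain ⟨S, hS⟩ := hImon
  set M : Set (Fin n →₀ ℕ) := {ν | monomial ν (1 : K) ∈ I} with hMdef
  have hM : IsUpperSet M := by
    intro a b hab ha
    have : monomial b (1 : K) = monomial (b - a) 1 * monomial a 1 := by
      rw [monomial_mul, tsub_add_cancel_of_le hab, one_mul]
    change monomial b (1 : K) ∈ I
    rw [this]
    exact I.mul_mem_left _ ha
  have h0 : (0 : Fin n →₀ ℕ) ∉ M := by
    intro h
    exact hIT ((Ideal.eq_top_iff_one _).mpr h)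
  have hmem : ∀ f : MvPolynomial (Fin n) K, f ∈ I ↔ ∀ ν ∈ f.support, ν ∈ M := by
    intro f
    constructor
    · intro hf ν hν
      rw [hS, mem_ideal_span_monomial_image] at hf
      obtain ⟨a, ha, hle⟩ := hf ν hν
      refine hM hle ?_
      change monomial a (1 : K) ∈ I
      rw [hS]
      exact Ideal.subset_span ⟨a, ha, rfl⟩
    · intro h
      rw [f.as_sum]
      refine Ideal.sum_mem _ fun ν hν => ?_
      rw [← mul_one (coeff ν f), ← C_mul_monomial]
      exact I.mul_mem_left _ (h ν hν)
  have hX : ∀ (k : Fin n) (s : ℕ) (f : MvPolynomial (Fin n) K),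
      X k ^ s * f ∈ I ↔ ∀ ν ∈ f.support, ν + Finsupp.single k s ∈ M := by
    intro k s f
    rw [hmem, X_pow_eq_monomial]
    constructor
    · intro h ν hν
      apply h
      rw [mem_support_iff, add_comm, coeff_monomial_mul, one_mul]
      exact mem_support_iff.mp hν
    · intro h ν hν
      rw [mem_support_iff, coeff_monomial_mul'] at hν
      split_ifs at hν with hle
      · rw [← tsub_add_cancel_of_le hle]
        apply h
        rw [mem_support_iff]
        simpa using hν
      · exact absurd rfl hν
  have hXs : ∀ (k i : Fin n), k ≤ i → ∀ s : ℕ, (X i ^ s : MvPolynomial (Fin n) K) ∈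
      ((Ideal.span {p | ∃ i : Fin n, k ≤ i ∧ p = X i}) ^ s :
        Ideal (MvPolynomial (Fin n) K)) := by
    intro k i hki s
    apply Ideal.pow_mem_pow
    apply Ideal.subset_span
    exact ⟨i, hki, rfl⟩
  have hDiff : (∀ (k i : Fin n), k ≤ i → ∀ μ s, μ + Finsupp.single k s ∈ M →
      ∃ t, μ + Finsupp.single i t ∈ M) ↔ ∀ k : Fin n,
        {f : MvPolynomial (Fin n) K | ∃ s : ℕ, X k ^ s * f ∈ I} =
        {f : MvPolynomial (Fin n) K | ∃ s : ℕ,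
          ∀ g ∈ ((Ideal.span {p | ∃ i : Fin n, k ≤ i ∧ p = X i}) ^ s :
            Ideal (MvPolynomial (Fin n) K)), g * f ∈ I} := by
    constructor
    · intro hD k
      ext f
      constructor
      · rintro ⟨s, hs⟩
        rw [hX] at hs
        obtain ⟨N, hN⟩ := Ideal.exists_pow_le_of_le_radical_of_fg
          (I := Ideal.span {p : MvPolynomial (Fin n) K | ∃ i : Fin n, k ≤ i ∧ p = X i})
          (J := I.colon {f}) (by
            rw [Ideal.span_le]
            rintro _ ⟨i, hki, rfl⟩
            have : ∀ ν, ∃ t, ν ∈ f.support → ν + Finsupp.single i t ∈ M := by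
              intro ν
              by_cases hν : ν ∈ f.support
              · obtain ⟨t, ht⟩ := hD k i hki ν s (hs ν hν)
                exact ⟨t, fun _ => ht⟩
              · exact ⟨0, fun h => absurd h hν⟩
            choose t ht using this
            refine ⟨f.support.sup t, ?_⟩
            rw [Submodule.mem_colon_singleton, smul_eq_mul, hX]
            intro ν hν
            refine hM ?_ (ht ν hν)
            gcongr
            exact Finset.le_sup hν)
          (IsNoetherian.noetherian _)
        refine ⟨N, fun g hg => ?_⟩
        have := hN hg
        rwa [Submodule.mem_colon_singleton, smul_eq_mul] at this
      · rintro ⟨s, hs⟩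
        exact ⟨s, hs (X k ^ s) (hXs k k le_rfl s)⟩
    · intro hE k i hki μ s hμ
      have hs1 : (monomial μ (1 : K)).support = {μ} := by
        classical
        rw [support_monomial, if_neg one_ne_zero]
      have h1 : monomial μ (1 : K) ∈ {f : MvPolynomial (Fin n) K | ∃ s : ℕ, X k ^ s * f ∈ I} := by
        refine ⟨s, ?_⟩
        rw [hX, hs1]
        simpa using hμ
      rw [hE k] at h1
      obtain ⟨t, ht⟩ := h1
      have h2 := ht (X i ^ t) (hXs k i hki t)
      rw [hX, hs1] at h2
      exact ⟨t, h2 μ (by simp)⟩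
  rw [← hDiff]
  constructor
  · rintro ⟨H, hfin, hspan, hH⟩
    refine D_of_pb hM h0 hfin ?_ ?_
    · intro h hh
      change monomial h (1 : K) ∈ I
      rw [hspan]
      exact Ideal.subset_span ⟨h, hh, rfl⟩
    · intro ν hν
      obtain ⟨μ, ⟨h1, h2⟩, -⟩ := hH ν hν
      exact ⟨μ, h1, h2⟩
  · intro hD
    refine ⟨pbSet M, pb_finite hM hD, ?_, ?_⟩
    · ext f
      rw [mem_ideal_span_monomial_image, hmem]
      refine forall₂_congr fun ν _ => ?_
      constructor
      · intro hν
        obtain ⟨μ, hμ, hd⟩ := pb_exists h0 _ ν rfl hν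
        exact ⟨μ, hμ, hd.1⟩
      · rintro ⟨μ, hμ, hle⟩
        exact hM hle hμ.1
    · intro ν hν
      obtain ⟨μ, hμ, hd⟩ := pb_exists h0 _ ν rfl hν
      exact ⟨μ, ⟨hμ, hd⟩, fun μ' h' => pb_unique hM h'.1 hμ h'.2 hd⟩
end

section
/- Let I be a proper nonzero monomial ideal of P. Then I is quasi-stable if and only if the following holds: whenever x^μ ∈ I and μ_i > 0 for some 1 ≤ i < n, then for each 0 < r ≤ μ_i and each i < j ≤ n there exists an integer s ≥ 0 such that x_j^s · x^μ / x_i^r ∈ I. -/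
open MvPolynomial

lemma cls_le_of_ne {n : ℕ} {μ : Fin n →₀ ℕ} {i : Fin n} (h : μ i ≠ 0) : cls μ ≤ i :=
  Nat.sInf_le ⟨i.2, h⟩

lemma eq_zero_of_lt_cls {n : ℕ} {μ : Fin n →₀ ℕ} {i : Fin n} (h : (i : ℕ) < cls μ) : μ i = 0 := by
  by_contra h0
  have := cls_le_of_ne h0
  omega

lemma exists_cls {n : ℕ} {μ : Fin n →₀ ℕ} (h : μ ≠ 0) :
    ∃ c : Fin n, (c : ℕ) = cls μ ∧ μ c ≠ 0 := by
  have hne : {i : ℕ | ∃ hi : i < n, μ ⟨i, hi⟩ ≠ 0}.Nonempty := by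
    obtain ⟨i, hi⟩ := Finsupp.ne_iff.1 h
    exact ⟨i, i.2, hi⟩
  obtain ⟨hc, hc'⟩ := Nat.sInf_mem hne
  exact ⟨⟨_, hc⟩, rfl, hc'⟩

lemma cls_anti {n : ℕ} {μ ν : Fin n →₀ ℕ} (h : μ ≠ 0) (hle : μ ≤ ν) : cls ν ≤ cls μ := by
  obtain ⟨c, hc, hc'⟩ := exists_cls h
  rw [← hc]
  apply cls_le_of_ne
  have := hle c
  omega

lemma InvDiv.trans' {n : ℕ} {a b c : Fin n →₀ ℕ} (ha : a ≠ 0) (h1 : InvDiv a b)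
    (h2 : InvDiv b c) : InvDiv a c := by
  refine ⟨h1.1.trans h2.1, fun j hj => ?_⟩
  by_cases hb : b j = a j
  · exact (h2.2 j (by rw [hb]; exact hj)).trans (cls_anti ha h1.1)
  · exact h1.2 j hb

/-- Two involutive divisors of the same monomial are comparable. -/
lemma InvDiv.comparable {n : ℕ} {a b v : Fin n →₀ ℕ}
    (h1 : InvDiv a v) (h2 : InvDiv b v) (hc : cls a ≤ cls b) : InvDiv a b ∨ InvDiv b a := by
  have ea : ∀ j : Fin n, cls a < j → a j = v j := fun j hj => by
    by_contra h; have := h1.2 j (Ne.symm h); omega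
  have eb : ∀ j : Fin n, cls b < j → b j = v j := fun j hj => by
    by_contra h; have := h2.2 j (Ne.symm h); omega
  have za : ∀ j : Fin n, (j : ℕ) < cls a → a j = 0 := fun j hj => eq_zero_of_lt_cls hj
  have zb : ∀ j : Fin n, (j : ℕ) < cls b → b j = 0 := fun j hj => eq_zero_of_lt_cls hj
  have la := h1.1
  have lb := h2.1
  by_cases hab : a ≤ b
  · left
    refine ⟨hab, fun j hj => ?_⟩
    by_contra hlt
    push Not at hlt
    have h3 := ea j hlt
    have h4 := hab j
    have h5 := lb j
    omega
  · right
    have key : b ≤ a := by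
      rw [Finsupp.le_def] at hab
      push Not at hab
      obtain ⟨i, hi⟩ := hab
      intro j
      have h5 := lb j
      have h6 := la i
      rcases lt_trichotomy (j : ℕ) (cls b) with h | h | h
      · rw [zb j h]; exact Nat.zero_le _
      · rcases hc.lt_or_eq with h' | h'
        · rw [ea j (by omega)]; exact h5
        · have hij : i = j := by
            rcases lt_trichotomy (i : ℕ) (cls b) with g | g | g
            · rw [za i (by omega)] at hi; omega
            · exact Fin.ext (by omega)
            · rw [ea i (by omega), eb i g] at hi; omega
          subst hij
          exact hi.le
      · rw [ea j (by omega)]; exact h5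
    refine ⟨key, fun j hj => ?_⟩
    by_contra hlt
    push Not at hlt
    have h3 := eb j hlt
    have h4 := key j
    have h5 := la j
    omega

lemma exists_finite_gens {n : ℕ} (M : Set (Fin n →₀ ℕ)) :
    ∃ G : Set (Fin n →₀ ℕ), G.Finite ∧ G ⊆ M ∧ ∀ h ∈ M, ∃ g ∈ G, g ≤ h := by
  refine ⟨{g | Minimal (· ∈ M) g}, ?_, fun g hg => hg.1, fun h hh => ?_⟩
  · exact (setOfPred_minimal_antichain _).finite_of_partiallyWellOrderedOn (Set.isPWO_of_wellQuasiOrderedLE _)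
  · obtain ⟨g, h1, h2⟩ := exists_minimal_le_of_wellFoundedLT (· ∈ M) h hh
    exact ⟨g, h2, h1⟩

lemma finite_bound {n : ℕ} {G : Set (Fin n →₀ ℕ)} (hG : G.Finite) :
    ∃ D : ℕ, ∀ g ∈ G, ∀ i, g i ≤ D := by
  obtain ⟨u, hu⟩ := hG.bddAbove
  refine ⟨∑ i, u i, fun g hg i => (hu hg i).trans ?_⟩
  exact Finset.single_le_sum (f := fun i => u i) (fun _ _ => Nat.zero_le _) (Finset.mem_univ i)

theorem comb_backward {n : ℕ} (M : Set (Fin n →₀ ℕ)) (hup : IsUpperSet M) (h0 : 0 ∉ M)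
    (hC : ∀ μ ∈ M, ∀ i j : Fin n, i < j → 0 < μ i →
      ∃ s : ℕ, μ - Finsupp.single i (μ i) + Finsupp.single j s ∈ M) :
    ∃ H : Set (Fin n →₀ ℕ), H.Finite ∧ H ⊆ M ∧ ∀ ν ∈ M, ∃! μ, μ ∈ H ∧ InvDiv μ ν := by
  have hne : ∀ a ∈ M, a ≠ 0 := fun a ha h => h0 (h ▸ ha)
  refine ⟨{h | h ∈ M ∧ ∀ k ∈ M, InvDiv k h → k = h}, ?_, fun h hh => hh.1, ?_⟩
  · obtain ⟨G, hGf, hGM, hG⟩ := exists_finite_gens M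
    obtain ⟨D, hD⟩ := finite_bound hGf
    have hS : ∃ S : ℕ, ∀ g ∈ G, ∀ i j : Fin n, i < j → 0 < g i →
        g - Finsupp.single i (g i) + Finsupp.single j S ∈ M := by
      have h1 : ∀ g : Fin n →₀ ℕ, ∀ i j : Fin n, ∃ s : ℕ, g ∈ M → i < j → 0 < g i →
          g - Finsupp.single i (g i) + Finsupp.single j s ∈ M := by
        intro g i j
        by_cases h : g ∈ M ∧ i < j ∧ 0 < g i
        · obtain ⟨s, hs⟩ := hC g h.1 i j h.2.1 h.2.2
          exact ⟨s, fun _ _ _ => hs⟩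
        · exact ⟨0, fun a b c => absurd ⟨a, b, c⟩ h⟩
      choose s hs using h1
      refine ⟨∑ g ∈ hGf.toFinset, ∑ i, ∑ j, s g i j, fun g hg i j hij hi => ?_⟩
      refine hup ?_ (hs g i j (hGM hg) hij hi)
      gcongr
      calc s g i j ≤ ∑ j, s g i j :=
            Finset.single_le_sum (f := fun j => s g i j) (fun _ _ => Nat.zero_le _) (Finset.mem_univ j)
        _ ≤ ∑ i, ∑ j, s g i j :=
            Finset.single_le_sum (f := fun i => ∑ j, s g i j) (fun _ _ => Nat.zero_le _)
              (Finset.mem_univ i)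
        _ ≤ _ :=
            Finset.single_le_sum (f := fun g => ∑ i, ∑ j, s g i j) (fun _ _ => Nat.zero_le _)
              (hGf.mem_toFinset.2 hg)
    obtain ⟨S, hS⟩ := hS
    refine (Set.finite_Iic (Finsupp.equivFunOnFinite.symm fun _ : Fin n => D + S)).subset ?_
    rintro h ⟨hM, hmin⟩ j
    change h j ≤ D + S
    obtain ⟨c, hc, hc'⟩ := exists_cls (hne h hM)
    have hle : h - Finsupp.single c 1 ≤ h := tsub_le_self
    have hnot : h - Finsupp.single c 1 ∉ M := by
      intro hmem
      have := hmin _ hmem ⟨hle, fun k hk => ?_⟩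
      · have := DFunLike.congr_fun this c
        simp at this
        omega
      · have hkc : k = c := by
          by_contra hkc
          exact hk (by simp [Finsupp.single_apply, Ne.symm hkc])
        rw [hkc, hc]
        exact cls_anti (hne _ hmem) hle
    obtain ⟨g, hgG, hgh⟩ := hG h hM
    have hgc : g c = h c := by
      by_contra hgc
      apply hnot
      refine hup ?_ (hGM hgG)
      intro k
      have h1 := hgh k
      by_cases hk : c = k
      · subst hk; simp; omega
      · simp [Finsupp.single_apply, hk]; exact h1
    rcases lt_trichotomy j c with hj | hj | hj
    · rw [eq_zero_of_lt_cls (by rw [← hc]; exact hj)]; exact Nat.zero_le _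
    · subst hj
      have := hD g hgG j
      omega
    · by_contra hlt
      apply hnot
      refine hup ?_ (hS g hgG c j hj (by omega))
      intro k
      have h1 := hgh k
      have h2 := hD g hgG k
      by_cases hk : c = k
      · subst hk; simp [hj.ne']
      · by_cases hkj : j = k
        · subst hkj
          simp [Finsupp.single_apply, hk]; omega
        · simp [Finsupp.single_apply, hk, hkj]; exact h1
  · intro ν hν
    obtain ⟨m, ⟨hmM, hmd⟩, hmin⟩ := WellFounded.has_min (wellFounded_lt (α := Fin n →₀ ℕ))
      {k | k ∈ M ∧ InvDiv k ν} ⟨ν, hν, le_rfl, fun j hj => absurd rfl hj⟩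
    refine ⟨m, ⟨⟨hmM, fun k hk hkm => ?_⟩, hmd⟩, ?_⟩
    · by_contra hne'
      exact hmin k ⟨hk, hkm.trans' (hne k hk) hmd⟩ (lt_of_le_of_ne hkm.1 hne')
    · rintro k ⟨⟨hk, hkmin⟩, hkd⟩
      have hm' : ∀ l ∈ M, InvDiv l m → l = m := fun l hl hlm => by
        by_contra hne'
        exact hmin l ⟨hl, hlm.trans' (hne l hl) hmd⟩ (lt_of_le_of_ne hlm.1 hne')
      have : InvDiv m k ∨ InvDiv k m := by
        rcases le_total (cls m) (cls k) with h | h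
        · exact hmd.comparable hkd h
        · exact (hkd.comparable hmd h).symm
      rcases this with h | h
      · exact (hkmin m hmM h).symm
      · exact hm' k hk h

lemma mono_up {n : ℕ} {K : Type*} [Field K] (I : Ideal (MvPolynomial (Fin n) K)) :
    IsUpperSet {μ : Fin n →₀ ℕ | monomial μ (1 : K) ∈ I} := by
  intro a b hab ha
  have : monomial b (1 : K) = monomial (b - a) 1 * monomial a 1 := by
    rw [monomial_mul, tsub_add_cancel_of_le hab, one_mul]
  change monomial b (1 : K) ∈ I
  rw [this]
  exact I.mul_mem_left _ ha

/-- Thm. 3.4 (i)⇔(vi): a monomial ideal `I` is quasi-stable iff whenever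
`x^μ ∈ I` with `μ_i > 0` for some `i < n`, then for each `0 < r ≤ μ_i` and `j > i` there is
`s ≥ 0` with `x_j^s x^μ / x_i^r ∈ I`.  (1-based `1 ≤ i < n` is 0-based `(i : ℕ) + 1 < n`.) -/
theorem statement12 {n : ℕ} {K : Type*} [Field K]
    (I : Ideal (MvPolynomial (Fin n) K)) (hImon : IsMonIdeal I) (hI0 : I ≠ ⊥) (hIT : I ≠ ⊤) :
    QuasiStable I ↔
      ∀ μ : Fin n →₀ ℕ, monomial μ (1 : K) ∈ I →
        ∀ i : Fin n, (i : ℕ) + 1 < n → 0 < μ i →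
          ∀ r : ℕ, 0 < r → r ≤ μ i →
            ∀ j : Fin n, i < j →
              ∃ s : ℕ,
                monomial (μ - Finsupp.single i r + Finsupp.single j s) (1 : K) ∈ I := by
  constructor
  · rintro ⟨H, hf, hI, hH⟩ μ hμ i _ _ r _ _ j hij
    obtain ⟨D, hD⟩ := finite_bound hf
    refine ⟨D + 1, ?_⟩
    have hν : monomial (μ + Finsupp.single j (D + 1)) (1 : K) ∈ I :=
      mono_up I (le_self_add : μ ≤ μ + Finsupp.single j (D + 1)) hμ
    obtain ⟨h, ⟨hh, hle, hinv⟩, -⟩ := hH _ hν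
    have hhI : monomial h (1 : K) ∈ I := by
      rw [hI]; exact Ideal.subset_span ⟨h, hh, rfl⟩
    refine mono_up I ?_ hhI
    have hjc : (j : ℕ) ≤ cls h := by
      apply hinv
      have := hD h hh j
      simp
      omega
    intro k
    by_cases hk : i = k
    · subst hk
      rw [eq_zero_of_lt_cls (lt_of_lt_of_le hij hjc)]
      exact Nat.zero_le _
    · have := hle k
      simpa [Finsupp.single_apply, hk] using this
  · intro hC
    obtain ⟨S, hS⟩ := hImon
    obtain ⟨H, hf, hHM, hH⟩ := comb_backward {μ : Fin n →₀ ℕ | monomial μ (1 : K) ∈ I}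
      (mono_up I) (fun h => hIT ((Ideal.eq_top_iff_one I).2 h))
      (fun μ hμ i j hij hi => hC μ hμ i (by have := j.2; have : (i : ℕ) < j := hij; omega)
        hi (μ i) hi le_rfl j hij)
    refine ⟨H, hf, le_antisymm ?_ ?_, hH⟩
    · conv_lhs => rw [hS]
      rw [Ideal.span_le]
      rintro _ ⟨μ, hμ, rfl⟩
      obtain ⟨h, ⟨hh, hle, -⟩, -⟩ := hH μ (by
        change monomial μ (1 : K) ∈ I
        rw [hS]; exact Ideal.subset_span ⟨μ, hμ, rfl⟩)
      have hm : monomial h (1 : K) ∈ Ideal.span ((fun μ => monomial μ (1 : K)) '' H) :=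
        Ideal.subset_span ⟨h, hh, rfl⟩
      exact mono_up (Ideal.span ((fun μ => monomial μ (1 : K)) '' H)) hle hm
    · rw [Ideal.span_le]
      rintro _ ⟨μ, hμ, rfl⟩
      exact hHM hμ
end
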